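/- arXiv:1203.0621 — 5 statements merged into one kernel-verified Lean document; each statement's English description precedes it below -/
import Mathlib

section
/- In A(S^{2n+1}_q), the (n+1)×(n+1) matrix P with entries p_{ij} := z_i^* z_j is a self-adjoint idempotent, i.e. Σ_{j=0}^n p_{ij} p_{jk} = p_{ik} and p_{ij}^* = p_{ji} for all i,k, and its q-trace equals one: Tr_q(P) := Σ_{i=0}^n q^{2i} p_{ii} = 1. -/
/-!
STATEMENT 1: In `A(S^{2n+1}_q)`, the matrix `P` with entries `p_{ij} := z_i^* z_j`
is a self-adjoint idempotent: `∑_j p_{ij} p_{jk} = p_{ik}` and `p_{ij}^* = p_{ji}`,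
and its q-trace equals one: `∑_i q^{2i} p_{ii} = 1`.
-/

theorem defining_projection_of_CPnq
    (q : ℝ) (hq0 : 0 < q) (hq1 : q < 1) (n : ℕ) (hn : 1 ≤ n)
    (A : Type*) [Ring A] [Algebra ℂ A] [StarRing A] [StarModule ℂ A]
    (z : Fin (n + 1) → A)
    (rel_zz : ∀ i j : Fin (n + 1), i < j → z i * z j = ((q : ℂ)⁻¹) • (z j * z i))
    (rel_zstar : ∀ i j : Fin (n + 1), i ≠ j →
      star (z i) * z j = (q : ℂ) • (z j * star (z i)))
    (rel_last : star (z (Fin.last n)) * z (Fin.last n)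
      = z (Fin.last n) * star (z (Fin.last n)))
    (rel_comm : ∀ i : Fin (n + 1), (i : ℕ) < n →
      star (z i) * z i - z i * star (z i)
        = ((1 : ℂ) - (q : ℂ) ^ 2) • ∑ j ∈ Finset.Ioi i, z j * star (z j))
    (sphere : ∑ j : Fin (n + 1), z j * star (z j) = 1)
    -- the entries of the matrix P
    (p : Fin (n + 1) → Fin (n + 1) → A)
    (hp : ∀ i j, p i j = star (z i) * z j) :
    (∀ i k : Fin (n + 1), ∑ j : Fin (n + 1), p i j * p j k = p i k)
    ∧ (∀ i j : Fin (n + 1), star (p i j) = p j i)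
    ∧ (∑ i : Fin (n + 1), ((q : ℂ) ^ (2 * (i : ℕ))) • p i i = 1) := by
  refine ⟨fun i k => ?_, fun i j => ?_, ?_⟩
  · simp only [hp]
    have h : ∀ j, star (z i) * z j * (star (z j) * z k)
        = star (z i) * (z j * star (z j)) * z k := fun j => by simp only [mul_assoc]
    simp only [h]
    rw [← Finset.sum_mul, ← Finset.mul_sum, sphere, mul_one]
  · simp [hp]
  · have key : ∀ i : Fin (n + 1), p i i = z i * star (z i)
        + ((1 : ℂ) - (q : ℂ) ^ 2) • ∑ j ∈ Finset.Ioi i, z j * star (z j) := by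
      intro i
      rw [hp]
      by_cases hi : (i : ℕ) < n
      · rw [← rel_comm i hi]; abel
      · have : i = Fin.last n := by
          apply Fin.ext
          have := i.isLt
          simp only [Fin.val_last]
          omega
        subst this
        rw [rel_last]
        have he : Finset.Ioi (Fin.last n) = ∅ := by
          ext j
          simp [Fin.le_last]
        simp [he]
    have geo : ∀ j : Fin (n + 1), ∑ i ∈ Finset.Iio j,
        ((q : ℂ) ^ (2 * (i : ℕ))) * ((1 : ℂ) - (q : ℂ) ^ 2) = 1 - (q : ℂ) ^ (2 * (j : ℕ)) := by
      intro j
      have h1 : ∀ m : ℕ, ∑ i ∈ Finset.Iio m, ((q : ℂ) ^ (2 * i)) * ((1 : ℂ) - (q : ℂ) ^ 2)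
          = 1 - (q : ℂ) ^ (2 * m) := by
        intro m
        rw [Nat.Iio_eq_range]
        induction m with
        | zero => simp
        | succ m ih => rw [Finset.sum_range_succ, ih]; ring
      rw [← h1, ← Fin.map_valEmbedding_Iio, Finset.sum_map]
      rfl
    simp only [key, smul_add, Finset.sum_add_distrib, Finset.smul_sum, smul_smul]
    rw [Finset.sum_comm' (t' := Finset.univ) (s' := fun j => Finset.Iio j) (by simp)]
    simp only [← Finset.sum_smul, geo]
    rw [← Finset.sum_add_distrib, ← sphere]
    refine Finset.sum_congr rfl fun j _ => ?_
    rw [← add_smul, add_sub_cancel, one_smul]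
end

section
/- For every N∈ℤ, the vector Ψ_N with components ψ^N_{j_0,…,j_n} satisfies Ψ_N^† Ψ_N = Σ_{j_0+⋯+j_n=|N|} (ψ^N_{j_0,…,j_n})^* ψ^N_{j_0,…,j_n} = 1 in A(S^{2n+1}_q). -/
/-!
STATEMENT 2: For every `N ∈ ℤ`, the vector `Ψ_N` with components `ψ^N_{j_0,…,j_n}`
satisfies `Ψ_N^† Ψ_N = ∑_{j_0+⋯+j_n=|N|} (ψ^N_J)^* ψ^N_J = 1` in `A(S^{2n+1}_q)`.
-/

noncomputable section

/-- The q-integer `[m] = (q^m - q^{-m})/(q - q^{-1})`. -/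
def qNum (q : ℝ) (m : ℕ) : ℝ := (q ^ m - q⁻¹ ^ m) / (q - q⁻¹)

/-- The q-factorial `[m]! = [m][m-1]⋯[1]`, with `[0]! = 1`. -/
def qFact (q : ℝ) : ℕ → ℝ
  | 0 => 1
  | m + 1 => qNum q (m + 1) * qFact q m

/-- The q-multinomial coefficient `[j_0,…,j_n]! = [j_0+⋯+j_n]!/([j_0]!⋯[j_n]!)`. -/
def qMultinomial (q : ℝ) {k : ℕ} (j : Fin k → ℕ) : ℝ :=
  qFact q (∑ i, j i) / ∏ i, qFact q (j i)

/-- The component `ψ^N_{j_0,…,j_n}` of the vector `Ψ_N`: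
for `N ≥ 0` it is `[j]!^{1/2} q^{-(1/2)∑_{r<s} j_r j_s} (z_0^*)^{j_0}⋯(z_n^*)^{j_n}`,
for `N < 0` it is `[j]!^{1/2} q^{(1/2)∑_{r<s} j_r j_s + ∑_r r j_r} z_0^{j_0}⋯z_n^{j_n}`. -/
def psiComp {A : Type*} [Ring A] [Algebra ℂ A] [StarRing A]
    (q : ℝ) (n : ℕ) (z : Fin (n + 1) → A) (N : ℤ) (j : Fin (n + 1) → ℕ) : A :=
  let e1 : ℝ := ∑ r : Fin (n + 1), ∑ s ∈ Finset.Ioi r, ((j r : ℝ) * (j s : ℝ))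
  if 0 ≤ N then
    (((Real.sqrt (qMultinomial q j) * q ^ (-(e1 / 2)) : ℝ) : ℂ)) •
      ((List.finRange (n + 1)).map (fun r => star (z r) ^ j r)).prod
  else
    (((Real.sqrt (qMultinomial q j) *
        q ^ (e1 / 2 + ∑ r : Fin (n + 1), ((r : ℕ) : ℝ) * (j r : ℝ)) : ℝ) : ℂ)) •
      ((List.finRange (n + 1)).map (fun r => (z r) ^ j r)).prod


def bump {n : ℕ} (i : Fin n) (j : Fin n → ℕ) : Fin n → ℕ := fun s => if s = i then j s + 1 else j s

def Rs {n : ℕ} (i : Fin n) (j : Fin n → ℕ) : ℕ := ∑ s, if i < s then j s else 0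

def Ls {n : ℕ} (i : Fin n) (j : Fin n → ℕ) : ℕ := ∑ s, if s < i then j s else 0

def Es {n : ℕ} (j : Fin n → ℕ) : ℕ := ∑ r, ∑ s, if r < s then j r * j s else 0

def Us {A : Type*} [Ring A] {n : ℕ} (v : Fin n → A) (j : Fin n → ℕ) : A :=
  ((List.finRange n).map (fun r => v r ^ j r)).prod

lemma bump_zero_tail {n : ℕ} (j : Fin (n+1) → ℕ) :
    (fun s : Fin n => bump 0 j s.succ) = fun s => j s.succ := by
  funext s; simp [bump, Fin.succ_ne_zero]

lemma bump_succ_tail {n : ℕ} (i : Fin n) (j : Fin (n+1) → ℕ) :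
    (fun s : Fin n => bump i.succ j s.succ) = bump i (fun s => j s.succ) := by
  funext s; simp [bump]

lemma bump_zero_zero {n : ℕ} (j : Fin (n+1) → ℕ) : bump 0 j 0 = j 0 + 1 := by simp [bump]

lemma bump_succ_zero {n : ℕ} (i : Fin n) (j : Fin (n+1) → ℕ) : bump i.succ j 0 = j 0 := by
  simp [bump, (Fin.succ_ne_zero i).symm]

lemma Us_succ {A : Type*} [Ring A] {n : ℕ} (v : Fin (n+1) → A) (j : Fin (n+1) → ℕ) :
    Us v j = v 0 ^ j 0 * Us (fun s : Fin n => v s.succ) (fun s => j s.succ) := by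
  simp [Us, List.finRange_succ, List.map_map, Function.comp_def]

lemma Es_succ {n : ℕ} (j : Fin (n+1) → ℕ) :
    Es j = j 0 * (∑ s : Fin n, j s.succ) + Es (fun s : Fin n => j s.succ) := by
  simp [Es, Fin.sum_univ_succ, Finset.mul_sum]

lemma Rs_zero {n : ℕ} (j : Fin (n+1) → ℕ) : Rs 0 j = ∑ s : Fin n, j s.succ := by
  simp [Rs, Fin.sum_univ_succ]

lemma Rs_succ {n : ℕ} (i : Fin n) (j : Fin (n+1) → ℕ) :
    Rs i.succ j = Rs i (fun s : Fin n => j s.succ) := by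
  simp [Rs, Fin.sum_univ_succ]

lemma Ls_zero {n : ℕ} (j : Fin (n+1) → ℕ) : Ls 0 j = 0 := by
  simp [Ls]

lemma Ls_succ {n : ℕ} (i : Fin n) (j : Fin (n+1) → ℕ) :
    Ls i.succ j = j 0 + Ls i (fun s : Fin n => j s.succ) := by
  simp [Ls, Fin.sum_univ_succ]

lemma sum_bump {n : ℕ} (i : Fin n) (j : Fin n → ℕ) : ∑ s, bump i j s = (∑ s, j s) + 1 := by
  have : ∀ s, bump i j s = j s + if s = i then 1 else 0 := by
    intro s; unfold bump; split_ifs <;> rfl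
  simp [this, Finset.sum_add_distrib]

lemma Rs_bump {n : ℕ} (i : Fin n) (j : Fin n → ℕ) : Rs i (bump i j) = Rs i j := by
  unfold Rs bump
  refine Finset.sum_congr rfl fun s _ => ?_
  by_cases h : i < s
  · simp [h, h.ne']
  · simp [h]

lemma Ls_bump {n : ℕ} (i : Fin n) (j : Fin n → ℕ) : Ls i (bump i j) = Ls i j := by
  unfold Ls bump
  refine Finset.sum_congr rfl fun s _ => ?_
  by_cases h : s < i
  · simp [h, h.ne]
  · simp [h]

lemma Es_bump {n : ℕ} (i : Fin n) (j : Fin n → ℕ) : Es (bump i j) = Es j + Ls i j + Rs i j := by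
  induction n with
  | zero => exact i.elim0
  | succ n ih =>
    refine Fin.cases ?_ (fun i => ?_) i
    · rw [Es_succ, bump_zero_tail, bump_zero_zero, Es_succ j, Ls_zero, Rs_zero]
      ring
    · have := sum_bump i (fun s => j s.succ)
      rw [Es_succ, bump_succ_tail, bump_succ_zero, ih, Es_succ j, Ls_succ, Rs_succ, this]
      ring

lemma qNum_add (p : ℝ) (hp : p ≠ 0) (a b : ℕ) :
    qNum p (a + b) = p⁻¹ ^ b * qNum p a + p ^ a * qNum p b := by
  unfold qNum
  rw [← mul_div_assoc, ← mul_div_assoc, ← add_div]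
  congr 1
  ring

lemma qNum_zero (p : ℝ) : qNum p 0 = 0 := by simp [qNum]

lemma qNum_sum (p : ℝ) (hp : p ≠ 0) {n : ℕ} (k : Fin n → ℕ) :
    ∑ i, p ^ Ls i k * p⁻¹ ^ Rs i k * qNum p (k i) = qNum p (∑ i, k i) := by
  induction n with
  | zero => simp [qNum]
  | succ n ih =>
    rw [Fin.sum_univ_succ, Fin.sum_univ_succ k, qNum_add p hp, ← ih, Ls_zero, Rs_zero,
      Finset.mul_sum]
    simp only [Ls_succ, Rs_succ]
    congr 1
    · ring
    · refine Finset.sum_congr rfl fun i _ => ?_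
      ring

lemma qNum_pos (p : ℝ) (hp : 0 < p) (hp1 : p ≠ 1) (m : ℕ) : 0 < qNum p (m + 1) := by
  unfold qNum
  rcases lt_or_gt_of_ne hp1 with h | h
  · have h1 : p < p⁻¹ := h.trans (one_lt_inv₀ hp |>.2 h)
    have := pow_lt_pow_left₀ h1 hp.le (Nat.succ_ne_zero m)
    exact div_pos_of_neg_of_neg (sub_neg.2 this) (sub_neg.2 h1)
  · have h1 : p⁻¹ < p := (inv_lt_one_of_one_lt₀ h).trans h
    have := pow_lt_pow_left₀ h1 (inv_pos.2 hp).le (Nat.succ_ne_zero m)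
    exact div_pos (sub_pos.2 this) (sub_pos.2 h1)

lemma qFact_pos (p : ℝ) (hp : 0 < p) (hp1 : p ≠ 1) (m : ℕ) : 0 < qFact p m := by
  induction m with
  | zero => simp [qFact]
  | succ m ih => exact mul_pos (qNum_pos p hp hp1 m) ih

lemma qNum_inv (p : ℝ) (m : ℕ) : qNum p⁻¹ m = qNum p m := by
  unfold qNum
  rw [inv_inv, ← neg_sub (p ^ m), ← neg_sub p, neg_div_neg_eq]

lemma qFact_inv (p : ℝ) (m : ℕ) : qFact p⁻¹ m = qFact p m := by
  induction m with
  | zero => rfl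
  | succ m ih => simp only [qFact, ih, qNum_inv]

lemma qMultinomial_inv (p : ℝ) {k : ℕ} (j : Fin k → ℕ) :
    qMultinomial p⁻¹ j = qMultinomial p j := by
  simp only [qMultinomial, qFact_inv]

lemma prod_bump (p : ℝ) {n : ℕ} (i : Fin n) (j : Fin n → ℕ) :
    ∏ s, qFact p (bump i j s) = qNum p (bump i j i) * ∏ s, qFact p (j s) := by
  rw [← Finset.mul_prod_erase _ _ (Finset.mem_univ i),
    ← Finset.mul_prod_erase _ (fun s => qFact p (j s)) (Finset.mem_univ i), ← mul_assoc]
  congr 1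
  · simp [bump, qFact]
  · refine Finset.prod_congr rfl fun s hs => ?_
    simp [bump, (Finset.mem_erase.1 hs).1]

lemma pow_comm_smul {A : Type*} [Ring A] [Algebra ℂ A] (c : ℂ) (x y : A)
    (h : x * y = c • (y * x)) (m : ℕ) : x ^ m * y = c ^ m • (y * x ^ m) := by
  induction m with
  | zero => simp
  | succ m ih =>
    rw [pow_succ' x, mul_assoc, ih, mul_smul_comm, ← mul_assoc, h, smul_mul_assoc, smul_smul,
      mul_assoc, pow_succ]

lemma Us_comm {A : Type*} [Ring A] [Algebra ℂ A] (c : ℂ) (y : A) {n : ℕ} (v : Fin n → A)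
    (h : ∀ s, v s * y = c • (y * v s)) (j : Fin n → ℕ) :
    Us v j * y = c ^ (∑ s, j s) • (y * Us v j) := by
  induction n with
  | zero => simp [Us]
  | succ n ih =>
    rw [Us_succ, mul_assoc, ih _ (fun s => h s.succ), mul_smul_comm, ← mul_assoc,
      pow_comm_smul c _ _ (h 0), smul_mul_assoc, smul_smul, mul_assoc, Fin.sum_univ_succ,
      ← pow_add, add_comm]

lemma Us_mul {A : Type*} [Ring A] [Algebra ℂ A] (c : ℂ) {n : ℕ} (v : Fin n → A)
    (h : ∀ i s, i < s → v s * v i = c • (v i * v s)) (i : Fin n) (j : Fin n → ℕ) :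
    Us v j * v i = c ^ Rs i j • Us v (bump i j) := by
  induction n with
  | zero => exact i.elim0
  | succ n ih =>
    refine Fin.cases ?_ (fun i => ?_) i
    · rw [Us_succ, mul_assoc, Us_comm c (v 0) _ (fun s => h 0 s.succ (Fin.succ_pos s)),
        Us_succ v (bump 0 j), bump_zero_tail, bump_zero_zero, Rs_zero, mul_smul_comm, pow_succ,
        mul_assoc]
    · rw [Us_succ, mul_assoc,
        ih (fun s => v s.succ) (fun a b hab => h _ _ (Fin.succ_lt_succ_iff.2 hab)) i,
        Us_succ v (bump i.succ j), bump_succ_tail, bump_succ_zero, Rs_succ, mul_smul_comm]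

lemma sum_bump_reindex {M : Type*} [AddCommMonoid M] {n : ℕ} (N : ℕ) (i : Fin n)
    (g : (Fin n → ℕ) → M) (hg : ∀ k, k i = 0 → g k = 0) :
    ∑ j ∈ Finset.Nat.antidiagonalTuple n N, g (bump i j) =
      ∑ k ∈ Finset.Nat.antidiagonalTuple n (N+1), g k := by
  refine Finset.sum_of_injOn (bump i) ?_ ?_ ?_ (fun _ _ => rfl)
  · intro a _ b _ hab
    funext s
    have := congrFun hab s
    unfold bump at this
    split_ifs at this <;> omega
  · intro a ha
    simp only [Finset.mem_coe, Finset.Nat.mem_antidiagonalTuple] at ha ⊢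
    rw [sum_bump, ha]
  · intro k hk hk'
    apply hg
    by_contra h0
    apply hk'
    have hb : bump i (fun s => if s = i then k s - 1 else k s) = k := by
      funext s
      unfold bump
      by_cases hs : s = i
      · subst hs; simp; omega
      · simp [hs]
    refine ⟨fun s => if s = i then k s - 1 else k s, ?_, hb⟩
    simp only [Finset.mem_coe, Finset.Nat.mem_antidiagonalTuple] at hk ⊢
    have := sum_bump i (fun s => if s = i then k s - 1 else k s)
    rw [hb] at this
    omega

lemma main_aux (p : ℝ) (hp : 0 < p) (hp1 : p ≠ 1) {n : ℕ}
    {A : Type*} [Ring A] [Algebra ℂ A] [StarRing A] [StarModule ℂ A]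
    (v : Fin n → A)
    (h : ∀ i s, i < s → v s * v i = ((p⁻¹ : ℝ) : ℂ) • (v i * v s))
    (hs : ∑ i, star (v i) * v i = 1) (N : ℕ) :
    ∑ j ∈ Finset.Nat.antidiagonalTuple n N,
      ((qMultinomial p j * p⁻¹ ^ Es j : ℝ) : ℂ) • (star (Us v j) * Us v j) = 1 := by
  induction N with
  | zero =>
    rw [Finset.Nat.antidiagonalTuple_zero_right, Finset.sum_singleton]
    have : Us v 0 = 1 := by
      unfold Us
      apply List.prod_eq_one
      simp
    simp [this, qMultinomial, qFact, Es]
  | succ N ih =>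
    let g : Fin n → (Fin n → ℕ) → A := fun i k =>
      ((p ^ Ls i k * p⁻¹ ^ Rs i k * qNum p (k i) *
        (qFact p N / (∏ s, qFact p (k s)) * p⁻¹ ^ Es k) : ℝ) : ℂ) • (star (Us v k) * Us v k)
    have key : ∀ i, ∀ j ∈ Finset.Nat.antidiagonalTuple n N,
        star (v i) * (((qMultinomial p j * p⁻¹ ^ Es j : ℝ) : ℂ) • (star (Us v j) * Us v j)) * v i
          = g i (bump i j) := by
      intro i j hj
      rw [Finset.Nat.mem_antidiagonalTuple] at hj
      have h1 : star (v i) * (star (Us v j) * Us v j) * v i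
          = star (Us v j * v i) * (Us v j * v i) := by
        rw [star_mul]; simp only [mul_assoc]
      rw [mul_smul_comm, smul_mul_assoc, h1, Us_mul _ v h]
      simp only [g]
      rw [star_smul, smul_mul_smul_comm, smul_smul, Ls_bump, Rs_bump, prod_bump, Es_bump,
        qMultinomial, hj]
      congr 1
      have hstar : star ((((p⁻¹ : ℝ) : ℂ)) ^ Rs i j) = (((p⁻¹ : ℝ) : ℂ)) ^ Rs i j := by
        rw [star_pow]; congr 1; exact Complex.conj_ofReal _
      rw [hstar]
      norm_cast
      have hn : qNum p (bump i j i) ≠ 0 := by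
        simp only [bump, if_true]; exact (qNum_pos p hp hp1 _).ne'
      have hprod : ∏ s, qFact p (j s) ≠ 0 :=
        Finset.prod_ne_zero_iff.2 fun s _ => (qFact_pos p hp hp1 _).ne'
      have hpp : p ≠ 0 := hp.ne'
      have hL : p ^ Ls i j * p⁻¹ ^ Ls i j = 1 := by
        rw [← mul_pow, mul_inv_cancel₀ hpp, one_pow]
      rw [pow_add, pow_add]
      have e : qNum p (bump i j i) * (qFact p N / (qNum p (bump i j i) * ∏ s, qFact p (j s)))
          = qFact p N / ∏ s, qFact p (j s) := by
        field_simp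
      linear_combination (-(p⁻¹ ^ Rs i j * p⁻¹ ^ Rs i j * p⁻¹ ^ Es j) *
        (qFact p N / ∏ s, qFact p (j s))) * hL - (p ^ Ls i j * p⁻¹ ^ Rs i j * p⁻¹ ^ Es j * p⁻¹ ^ Ls i j *
          p⁻¹ ^ Rs i j) * e
    have hg : ∀ i k, k i = 0 → g i k = 0 := by
      intro i k hk
      simp [g, hk, qNum_zero]
    calc _ = ∑ k ∈ Finset.Nat.antidiagonalTuple n (N+1), ∑ i, g i k := by
          refine Finset.sum_congr rfl fun k hk => ?_
          rw [Finset.Nat.mem_antidiagonalTuple] at hk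
          simp only [g]
          rw [← Finset.sum_smul, ← Complex.ofReal_sum, ← Finset.sum_mul, qNum_sum p hp.ne', hk,
            qMultinomial, hk]
          congr 2
          simp only [qFact]
          ring
      _ = ∑ i, ∑ k ∈ Finset.Nat.antidiagonalTuple n (N+1), g i k := Finset.sum_comm
      _ = ∑ i, star (v i) * 1 * v i := by
          refine Finset.sum_congr rfl fun i _ => ?_
          rw [← sum_bump_reindex N i (g i) (hg i), ← ih, Finset.mul_sum, Finset.sum_mul]
          exact Finset.sum_congr rfl fun j hj => (key i j hj).symm
      _ = 1 := by simpa using hs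

lemma Us_smul {A : Type*} [Ring A] [Algebra ℂ A] {n : ℕ} (c : Fin n → ℂ) (v : Fin n → A)
    (j : Fin n → ℕ) : Us (fun r => c r • v r) j = (∏ r, c r ^ j r) • Us v j := by
  induction n with
  | zero => simp [Us]
  | succ n ih =>
    rw [Us_succ, Us_succ v, ih (fun s => c s.succ), Fin.prod_univ_succ, smul_pow,
      smul_mul_smul_comm]

lemma Es_cast {n : ℕ} (j : Fin n → ℕ) :
    (∑ r : Fin n, ∑ s ∈ Finset.Ioi r, ((j r : ℝ) * (j s : ℝ))) = (Es j : ℝ) := by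
  unfold Es
  push_cast
  refine Finset.sum_congr rfl fun r _ => ?_
  rw [← Finset.sum_filter]
  refine Finset.sum_congr ?_ fun _ _ => rfl
  ext; simp

lemma star_smul_mul_self {A : Type*} [Ring A] [Algebra ℂ A] [StarRing A] [StarModule ℂ A]
    (a : ℝ) (x : A) : star ((a : ℂ) • x) * ((a : ℂ) • x) = ((a * a : ℝ) : ℂ) • (star x * x) := by
  have : star (a : ℂ) = a := Complex.conj_ofReal a
  rw [star_smul, this, smul_mul_smul_comm, Complex.ofReal_mul]

lemma weighted_aux {A : Type*} [AddCommGroup A] [Module ℂ A] (q : ℝ) {n : ℕ} (x y : Fin (n+1) → A)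
    (hr : ∀ i : Fin (n + 1), y i - x i = ((1 : ℂ) - (q : ℂ) ^ 2) • ∑ j ∈ Finset.Ioi i, x j) :
    ∑ i : Fin (n+1), ((q : ℂ) ^ (2 * (i : ℕ))) • y i = ∑ i, x i := by
  have hy : ∀ i, y i = x i + ∑ j, if i < j then ((1 : ℂ) - (q : ℂ) ^ 2) • x j else 0 := by
    intro i
    rw [← sub_eq_iff_eq_add', hr, Finset.smul_sum, ← Finset.sum_filter]
    refine Finset.sum_congr ?_ fun _ _ => rfl
    ext; simp
  simp only [hy, smul_add, Finset.smul_sum, Finset.sum_add_distrib]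
  rw [Finset.sum_comm, ← Finset.sum_add_distrib]
  refine Finset.sum_congr rfl fun j _ => ?_
  simp only [smul_ite, smul_zero, smul_smul]
  have : ∀ i : Fin (n+1), (if i < j then ((q:ℂ) ^ (2 * (i:ℕ)) * (1 - (q:ℂ)^2)) • x j else 0)
      = (if i < j then ((q:ℂ) ^ (2 * (i:ℕ)) * (1 - (q:ℂ)^2)) else 0) • x j := by
    intro i; split_ifs <;> simp
  simp only [this]
  rw [← Finset.sum_smul, ← add_smul]
  have h2 : ∀ m ≤ n + 1, ∑ i : Fin (n+1), (if (i:ℕ) < m then ((q:ℂ) ^ (2 * (i:ℕ)) * (1 - (q:ℂ)^2)) else 0)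
      = 1 - (q:ℂ) ^ (2 * m) := by
    intro m hm
    rw [Fin.sum_univ_eq_sum_range
      (fun i => if i < m then ((q:ℂ) ^ (2 * i) * (1 - (q:ℂ)^2)) else 0), ← Finset.sum_filter]
    have : (Finset.range (n+1)).filter (· < m) = Finset.range m := by ext; simp; omega
    rw [this]
    clear this hm
    induction m with
    | zero => simp
    | succ m ih => rw [Finset.sum_range_succ, ih]; ring
  have h3 := h2 j (by omega)
  simp only [Fin.lt_def]
  rw [h3]; simp

theorem psi_dagger_psi_eq_one
    (q : ℝ) (hq0 : 0 < q) (hq1 : q < 1) (n : ℕ) (hn : 1 ≤ n)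
    (A : Type*) [Ring A] [Algebra ℂ A] [StarRing A] [StarModule ℂ A]
    (z : Fin (n + 1) → A)
    (rel_zz : ∀ i j : Fin (n + 1), i < j → z i * z j = ((q : ℂ)⁻¹) • (z j * z i))
    (rel_zstar : ∀ i j : Fin (n + 1), i ≠ j →
      star (z i) * z j = (q : ℂ) • (z j * star (z i)))
    (rel_last : star (z (Fin.last n)) * z (Fin.last n)
      = z (Fin.last n) * star (z (Fin.last n)))
    (rel_comm : ∀ i : Fin (n + 1), (i : ℕ) < n →
      star (z i) * z i - z i * star (z i)
        = ((1 : ℂ) - (q : ℂ) ^ 2) • ∑ j ∈ Finset.Ioi i, z j * star (z j))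
    (sphere : ∑ j : Fin (n + 1), z j * star (z j) = 1) :
    ∀ N : ℤ,
      ∑ j ∈ Finset.Nat.antidiagonalTuple (n + 1) N.natAbs,
        star (psiComp q n z N j) * psiComp q n z N j = 1 := by
  intro N
  have hqc : (q : ℂ) ≠ 0 := by exact_mod_cast hq0.ne'
  have hmn : ∀ j : Fin (n+1) → ℕ, 0 ≤ qMultinomial q j := fun j =>
    div_nonneg (qFact_pos q hq0 hq1.ne _).le
      (Finset.prod_nonneg fun s _ => (qFact_pos q hq0 hq1.ne _).le)
  by_cases hN : 0 ≤ N
  · rw [← main_aux q hq0 hq1.ne (fun i => star (z i)) ?_ (by simpa using sphere) N.natAbs]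
    · refine Finset.sum_congr rfl fun j _ => ?_
      simp only [psiComp, hN, if_true]
      rw [star_smul_mul_self, Es_cast]
      congr 2
      rw [mul_mul_mul_comm, Real.mul_self_sqrt (hmn j), ← Real.rpow_add hq0,
        ← neg_add, add_halves, Real.rpow_neg hq0.le, Real.rpow_natCast, inv_pow]
    · intro i s his
      have h1 := congrArg star (rel_zz i s his)
      have h2 : star ((q : ℂ)⁻¹) = ((q⁻¹ : ℝ) : ℂ) := by
        rw [← Complex.ofReal_inv]; exact Complex.conj_ofReal _
      rw [star_mul, star_smul, star_mul, h2] at h1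
      exact h1
  · have hs : ∑ i : Fin (n+1), star (((q ^ (i:ℕ) : ℝ) : ℂ) • z i) * (((q ^ (i:ℕ) : ℝ) : ℂ) • z i)
        = 1 := by
      rw [← sphere, ← weighted_aux q (fun i => z i * star (z i)) (fun i => star (z i) * z i)]
      · refine Finset.sum_congr rfl fun i _ => ?_
        rw [star_smul_mul_self]
        congr 1
        push_cast
        ring
      · intro i
        by_cases hi : (i : ℕ) < n
        · exact rel_comm i hi
        · have : i = Fin.last n := Fin.ext (by simp; omega)
          subst this
          have h0 : Finset.Ioi (Fin.last n) = ∅ := by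
            ext x; simpa using Fin.le_last x
          simp only [h0, rel_last, sub_self, Finset.sum_empty, smul_zero]
    have hinv : q⁻¹ ≠ 1 := by simpa using hq1.ne
    rw [← main_aux q⁻¹ (inv_pos.2 hq0) hinv
      (fun i : Fin (n+1) => ((q ^ (i:ℕ) : ℝ) : ℂ) • z i) ?_ hs N.natAbs]
    · refine Finset.sum_congr rfl fun j _ => ?_
      have hU := Us_smul (fun i : Fin (n+1) => ((q ^ (i:ℕ) : ℝ) : ℂ)) z j
      have hc : (∏ r : Fin (n+1), ((q ^ (r:ℕ) : ℝ) : ℂ) ^ j r)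
          = ((q ^ (∑ r : Fin (n+1), (r:ℕ) * j r) : ℝ) : ℂ) := by
        push_cast
        simp only [← pow_mul, Finset.prod_pow_eq_pow_sum]
      rw [hU, hc, star_smul_mul_self, smul_smul, ← Complex.ofReal_mul, qMultinomial_inv, inv_inv]
      simp only [psiComp, hN, if_false]
      rw [star_smul_mul_self, Es_cast]
      congr 2
      have hw : (∑ r : Fin (n + 1), ((r : ℕ) : ℝ) * (j r : ℝ))
          = ((∑ r : Fin (n+1), (r:ℕ) * j r : ℕ) : ℝ) := by push_cast; rfl
      rw [hw, mul_mul_mul_comm, Real.mul_self_sqrt (hmn j), Real.rpow_add hq0, Real.rpow_natCast,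
        mul_mul_mul_comm, ← Real.rpow_add hq0, add_halves, Real.rpow_natCast]
      ring
    · intro i s his
      rw [smul_mul_smul_comm, smul_mul_smul_comm, rel_zz i s his, smul_smul, smul_smul]
      congr 1
      rw [inv_inv]
      field_simp

end
end

section
/- If |j−k|>1 then π_{n,j}(a)·π_{n,k}(b) = 0 for all a,b ∈ A(S^{2n+1}_q). -/
/-!
STATEMENT 7: If `|j - k| > 1` then `π_{n,j}(a) · π_{n,k}(b) = 0` for all
`a, b ∈ A(S^{2n+1}_q)`.  The operators `π_{n,j}(a)`, for `a` running over
`A(S^{2n+1}_q)`, are exactly the elements of the non-unital *-subalgebra of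
`B(ℓ²(ℕ^n))` generated by the operators `π_{n,j}(z_i)`.
-/

noncomputable section
open scoped Classical

abbrev Hsp (n : ℕ) := lp (fun _ : (Fin n → ℕ) => ℂ) 2

def mval {n : ℕ} (m : Fin n → ℕ) (t : ℕ) : ℕ :=
  if h : 1 ≤ t ∧ t ≤ n then m ⟨t - 1, by omega⟩ else 0

def Vmem (n k : ℕ) (m : Fin n → ℕ) : Prop :=
  (∀ t : ℕ, 1 ≤ t → t + 1 ≤ k → mval m t ≤ mval m (t + 1)) ∧
  (∀ t : ℕ, k + 1 ≤ t → t + 1 ≤ n → mval m (t + 1) < mval m t)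

def eps (n i k : ℕ) : Fin n → ℕ :=
  fun t => if i ≤ (t : ℕ) ∧ (t : ℕ) + 1 ≤ k then 1 else 0

def IsPiRep (q : ℝ) (n k : ℕ) (Z : Fin (n + 1) → (Hsp n →L[ℂ] Hsp n)) : Prop :=
  (∀ i : Fin (n + 1), k < (i : ℕ) → Z i = 0) ∧
  (∀ m : Fin n → ℕ, ¬ Vmem n k m → ∀ i : Fin (n + 1), Z i (lp.single 2 m 1) = 0) ∧
  (∀ m : Fin n → ℕ, Vmem n k m → ∀ i : Fin (n + 1), (i : ℕ) + 1 ≤ k →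
    Z i (lp.single 2 m 1)
      = (((q ^ (mval m i) *
          Real.sqrt (1 - q ^ (2 * ((mval m ((i : ℕ) + 1) : ℝ) - (mval m i : ℝ) + 1)))
            : ℝ) : ℂ)) • lp.single 2 (m + eps n i k) 1) ∧
  (∀ m : Fin n → ℕ, Vmem n k m → ∀ i : Fin (n + 1), (i : ℕ) = k →
    Z i (lp.single 2 m 1) = (((q ^ (mval m k) : ℝ) : ℂ)) • lp.single 2 m 1)

def Supp (n k : ℕ) (T : Hsp n →L[ℂ] Hsp n) : Prop :=
  ∀ m : Fin n → ℕ, ¬ Vmem n k m →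
    T (lp.single 2 m 1) = 0 ∧ (star T) (lp.single 2 m 1) = 0

lemma coord_eq {n : ℕ} (m : Fin n → ℕ) (x : Hsp n) :
    x m = inner ℂ (lp.single 2 m (1 : ℂ) : Hsp n) x := by
  rw [lp.inner_single_left]
  simp

lemma coord_star {n : ℕ} (m : Fin n → ℕ) (T : Hsp n →L[ℂ] Hsp n) (x : Hsp n) :
    (T x) m = inner ℂ ((star T) (lp.single 2 m (1 : ℂ) : Hsp n)) x := by
  rw [coord_eq, ContinuousLinearMap.star_eq_adjoint, ContinuousLinearMap.adjoint_inner_left]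

lemma Vmem_add {n k i : ℕ} (hk : k ≤ n) {m : Fin n → ℕ} (h : Vmem n k m) :
    Vmem n k (m + eps n i k) := by
  constructor
  · intro t h1 h2
    have := h.1 t h1 h2
    have a1 : 1 ≤ t ∧ t ≤ n := by omega
    have a2 : 1 ≤ t + 1 ∧ t + 1 ≤ n := by omega
    simp only [mval, dif_pos a1, dif_pos a2, Pi.add_apply, eps] at this ⊢
    split_ifs <;> omega
  · intro t h1 h2
    have := h.2 t h1 h2
    have a1 : 1 ≤ t ∧ t ≤ n := by omega
    have a2 : 1 ≤ t + 1 ∧ t + 1 ≤ n := by omega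
    simp only [mval, dif_pos a1, dif_pos a2, Pi.add_apply, eps] at this ⊢
    split_ifs <;> omega

lemma Vmem_disj {n j k : ℕ} (hj : j ≤ n) (hk : k ≤ n) (hjk : 1 < |(j : ℤ) - (k : ℤ)|)
    {m : Fin n → ℕ} (h1 : Vmem n j m) (h2 : Vmem n k m) : False := by
  rcases lt_abs.1 hjk with h | h
  · have a := h1.1 (k + 1) (by omega) (by omega)
    have b := h2.2 (k + 1) (by omega) (by omega)
    omega
  · have a := h2.1 (j + 1) (by omega) (by omega)
    have b := h1.2 (j + 1) (by omega) (by omega)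
    omega

lemma supp_gen {q : ℝ} {n k : ℕ} (hk : k ≤ n) {Z : Fin (n + 1) → (Hsp n →L[ℂ] Hsp n)}
    (hZ : IsPiRep q n k Z) (i : Fin (n + 1)) : Supp n k (Z i) := by
  intro m hm
  obtain ⟨h1, h2, h3, h4⟩ := hZ
  refine ⟨h2 m hm i, ?_⟩
  ext p
  rw [coord_star, star_star]
  by_cases hp : Vmem n k p
  · rcases lt_trichotomy (i : ℕ) k with h | h | h
    · rw [h3 p hp i h, inner_smul_left, ← coord_eq, lp.single_apply_ne, mul_zero]
      · rfl
      · rintro rfl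
        exact hm (Vmem_add hk hp)
    · rw [h4 p hp i h, inner_smul_left, ← coord_eq, lp.single_apply_ne, mul_zero]
      · rfl
      · rintro rfl
        exact hm hp
    · rw [h1 i h]; simp
  · rw [h2 p hp i]; simp

lemma supp_adjoin {q : ℝ} {n k : ℕ} (hk : k ≤ n) {Z : Fin (n + 1) → (Hsp n →L[ℂ] Hsp n)}
    (hZ : IsPiRep q n k Z) (T : Hsp n →L[ℂ] Hsp n)
    (hT : T ∈ NonUnitalStarAlgebra.adjoin ℂ (Set.range Z)) : Supp n k T := by
  induction hT using NonUnitalStarAlgebra.adjoin_induction with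
  | mem x hx => obtain ⟨i, rfl⟩ := hx; exact supp_gen hk hZ i
  | add x y _ _ hx hy =>
    intro m hm
    simp [(hx m hm).1, (hx m hm).2, (hy m hm).1, (hy m hm).2]
  | zero => intro m hm; simp
  | mul x y _ _ hx hy =>
    intro m hm
    simp [(hx m hm).2, (hy m hm).1]
  | smul r x _ hx =>
    intro m hm
    simp [(hx m hm).1, (hx m hm).2]
  | star x _ hx =>
    intro m hm
    rw [star_star]
    exact ⟨(hx m hm).2, (hx m hm).1⟩

theorem pi_nj_mul_pi_nk_eq_zero
    (q : ℝ) (hq0 : 0 < q) (hq1 : q < 1) (n : ℕ) (hn : 1 ≤ n)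
    (j k : ℕ) (hj : j ≤ n) (hk : k ≤ n)
    (hjk : 1 < |(j : ℤ) - (k : ℤ)|)
    (Zj Zk : Fin (n + 1) → (Hsp n →L[ℂ] Hsp n))
    (hZj : IsPiRep q n j Zj) (hZk : IsPiRep q n k Zk) :
    ∀ S ∈ NonUnitalStarAlgebra.adjoin ℂ (Set.range Zj),
      ∀ T ∈ NonUnitalStarAlgebra.adjoin ℂ (Set.range Zk),
        S * T = 0 := by
  intro S hS T hT
  have sS := supp_adjoin hj hZj S hS
  have sT := supp_adjoin hk hZk T hT
  ext x p
  change (S (T x)) p = 0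
  rw [coord_star, lp.inner_eq_tsum]
  refine (tsum_congr fun m => ?_).trans tsum_zero
  by_cases hm : Vmem n j m
  · have hm' : ¬ Vmem n k m := fun h => Vmem_disj hj hk hjk hm h
    rw [coord_star m T, (sT m hm').2]
    simp
  · rw [coord_star m (star S), star_star, (sS m hm).1]
    simp


end
end

section
/- Let π_+^{(n)} := Σ_{k even, 0≤k≤n} π_{n,k} and π_−^{(n)} := Σ_{k odd, 0≤k≤n} π_{n,k}, which are representations of A(S^{2n+1}_q) on ℓ²(ℕ^n). Then for every a ∈ A(CP^n_q) the difference π_+^{(n)}(a) − π_−^{(n)}(a) is a trace-class operator on ℓ²(ℕ^n); furthermore its trace is given by a series which, as a function of q, is absolutely convergent on the open interval 0<q<1. -/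
/-!
STATEMENT 8: With `π_+^{(n)} = ∑_{k even} π_{n,k}` and `π_-^{(n)} = ∑_{k odd} π_{n,k}`,
for every `a ∈ A(CP^n_q)` the operator `π_+^{(n)}(a) - π_-^{(n)}(a)` is trace class on
`ℓ²(ℕ^n)`, and its trace is given by an absolutely convergent series.
Elements of `A(CP^n_q)` are (noncommutative) polynomials in the generators
`p_{il} = z_i^* z_l`; we realize them as elements of the free algebra on the symbols
`p_{il}` and represent them via `π_{n,k}(p_{il}) = π_{n,k}(z_i)^* π_{n,k}(z_l)`,
correcting the unit by the projection `P_k = π_{n,k}(1)` onto `V^n_k`.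
A bounded operator is trace class iff it is the product of two Hilbert-Schmidt
operators.
-/

noncomputable section
open scoped Classical

/-- Hilbert–Schmidt operator on `ℓ²(ℕ^n)`. -/
def IsHS {n : ℕ} (T : Hsp n →L[ℂ] Hsp n) : Prop :=
  Summable fun m : Fin n → ℕ => ‖T (lp.single 2 m 1)‖ ^ 2

/-- Trace-class operator: a product of two Hilbert–Schmidt operators. -/
def IsTraceClass {n : ℕ} (T : Hsp n →L[ℂ] Hsp n) : Prop :=
  ∃ S₁ S₂ : Hsp n →L[ℂ] Hsp n, IsHS S₁ ∧ IsHS S₂ ∧ T = S₁ * S₂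

lemma norm_bas {n : ℕ} (m : Fin n → ℕ) : ‖(lp.single 2 m 1 : Hsp n)‖ = 1 := by
  have := lp.norm_single (E := fun _ : (Fin n → ℕ) => ℂ) (p := 2) (by norm_num) m (1 : ℂ)
  simpa using this

lemma ext_bas {n : ℕ} {A B : Hsp n →L[ℂ] Hsp n}
    (h : ∀ m, A (lp.single 2 m 1) = B (lp.single 2 m 1)) : A = B := by
  ext1 x
  have hx := lp.hasSum_single (E := fun _ : (Fin n → ℕ) => ℂ) (p := 2) (by norm_num) x
  have hA := A.hasSum hx
  have hB := B.hasSum hx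
  have : (fun i => A (lp.single 2 i (x i))) = fun i => B (lp.single 2 i (x i)) := by
    funext i
    have : (lp.single 2 i (x i) : Hsp n) = (x i : ℂ) • lp.single 2 i 1 := by
      rw [← lp.single_smul]; simp
    rw [this, map_smul, map_smul, h]
  rw [this] at hA
  exact hA.unique hB

lemma sum_sq_hsp {n : ℕ} (x : Hsp n) :
    HasSum (fun m => ‖x m‖ ^ (2:ℝ)) (‖x‖ ^ (2:ℝ)) := by
  simpa using lp.hasSum_norm (p := 2) (by norm_num) x

lemma exists_op {n : ℕ} (v : (Fin n → ℕ) → Hsp n) (hv : Summable fun m => ‖v m‖ ^ 2) :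
    ∃ S : Hsp n →L[ℂ] Hsp n, ∀ m, S (lp.single 2 m 1) = v m := by
  have hv' : Summable fun m => ‖v m‖ ^ (2:ℝ) := by simpa using hv
  have key : ∀ x : Hsp n, Summable (fun m => ‖x m‖ * ‖v m‖) ∧
      ∑' m, ‖x m‖ * ‖v m‖ ≤ ‖x‖ * (∑' m, ‖v m‖ ^ (2:ℝ)) ^ (1 / (2:ℝ)) := by
    intro x
    have h := Real.summable_and_inner_le_Lp_mul_Lq_tsum_of_nonneg (p := 2) (q := 2)
      Real.HolderConjugate.two_two (f := fun m => ‖x m‖) (g := fun m => ‖v m‖)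
      (fun _ => norm_nonneg _) (fun _ => norm_nonneg _) (sum_sq_hsp x).summable hv'
    refine ⟨h.1, h.2.trans_eq ?_⟩
    rw [(sum_sq_hsp x).tsum_eq, ← Real.rpow_mul (norm_nonneg _)]
    norm_num
  have hs : ∀ x : Hsp n, Summable (fun m => (x m : ℂ) • v m) := fun x =>
    Summable.of_norm (by simpa [norm_smul] using (key x).1)
  let L : Hsp n →ₗ[ℂ] Hsp n :=
    { toFun := fun x => ∑' m, (x m : ℂ) • v m
      map_add' := by
        intro x y
        rw [← (hs x).tsum_add (hs y)]
        congr 1; funext m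
        rw [lp.coeFn_add, Pi.add_apply, add_smul]
      map_smul' := by
        intro c x
        rw [RingHom.id_apply, ← (hs x).tsum_const_smul]
        congr 1; funext m
        rw [lp.coeFn_smul, Pi.smul_apply, smul_eq_mul, mul_smul] }
  refine ⟨L.mkContinuous ((∑' m, ‖v m‖ ^ (2:ℝ)) ^ (1 / (2:ℝ))) ?_, ?_⟩
  · intro x
    have h1 : ‖∑' m, (x m : ℂ) • v m‖ ≤ ∑' m, ‖x m‖ * ‖v m‖ := by
      have := norm_tsum_le_tsum_norm (f := fun m => (x m : ℂ) • v m)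
        (by simpa [norm_smul] using (key x).1)
      simpa [norm_smul] using this
    rw [mul_comm]
    exact h1.trans (key x).2
  · intro m
    change ∑' i, ((lp.single 2 m 1 : Hsp n) i : ℂ) • v i = v m
    rw [tsum_eq_single m]
    · rw [lp.single_apply_self, one_smul]
    · intro i hi
      rw [lp.single_apply_ne _ _ _ hi, zero_smul]

lemma summable_pow_sum (r : ℝ) (h0 : 0 < r) (h1 : r < 1) (n : ℕ) :
    Summable fun m : Fin n → ℕ => r ^ (∑ t, m t) := by
  induction n with
  | zero => exact (hasSum_fintype _).summable
  | succ n ih =>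
    rw [← (Fin.consEquiv (fun _ : Fin (n+1) => ℕ)).summable_iff]
    have := (summable_geometric_of_lt_one h0.le h1).mul_of_nonneg ih
      (fun _ => by positivity) (fun _ => by positivity)
    refine this.congr ?_
    rintro ⟨a, m⟩
    simp [Fin.sum_univ_succ, pow_add]

lemma traceClass_of_bound {n : ℕ} (r C : ℝ) (h0 : 0 < r) (h1 : r < 1)
    (T : Hsp n →L[ℂ] Hsp n)
    (hT : ∀ m : Fin n → ℕ, ‖T (lp.single 2 m 1)‖ ≤ C * (r ^ (∑ t, m t)) ^ 2) :
    IsTraceClass T ∧ Summable (fun m : Fin n → ℕ =>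
          ‖(inner ℂ (T (lp.single 2 m 1)) (lp.single 2 m 1) : ℂ)‖) := by
  have hsum : Summable fun m : Fin n → ℕ => (r ^ (∑ t, m t)) ^ 2 := by
    have := summable_pow_sum (r ^ 2) (by positivity) (pow_lt_one₀ h0.le h1 (by norm_num)) n
    refine this.congr fun m => ?_
    rw [← pow_mul, ← pow_mul, mul_comm]
  constructor
  · let d : (Fin n → ℕ) → ℝ := fun m => r ^ (∑ t, m t)
    have hd : ∀ m, 0 < d m := fun m => by positivity
    have n2 : ∀ m, ‖((d m : ℂ)) • (lp.single 2 m 1 : Hsp n)‖ = d m := fun m => by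
      rw [norm_smul, norm_bas, Complex.norm_real, Real.norm_of_nonneg (hd m).le, mul_one]
    have n1 : ∀ m, ‖((d m : ℂ))⁻¹ • T (lp.single 2 m 1)‖ ≤ C * d m := fun m => by
      rw [norm_smul, norm_inv, Complex.norm_real, Real.norm_of_nonneg (hd m).le,
        inv_mul_le_iff₀ (hd m)]
      exact (hT m).trans_eq (by simp only [d]; ring)
    have s2 : Summable fun m => ‖((d m : ℂ)) • (lp.single 2 m 1 : Hsp n)‖ ^ 2 := by
      refine hsum.congr fun m => ?_
      rw [n2]
    have s1 : Summable fun m => ‖((d m : ℂ))⁻¹ • T (lp.single 2 m 1)‖ ^ 2 := by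
      refine Summable.of_nonneg_of_le (fun _ => by positivity) (fun m => ?_)
        (hsum.mul_left (C ^ 2))
      calc _ ≤ (C * d m) ^ 2 := by
            gcongr
            exact n1 m
        _ = _ := by rw [mul_pow]
    obtain ⟨S₁, hS₁⟩ := exists_op _ s1
    obtain ⟨S₂, hS₂⟩ := exists_op _ s2
    refine ⟨S₁, S₂, ?_, ?_, ?_⟩
    · unfold IsHS; simpa only [hS₁] using s1
    · unfold IsHS; simpa only [hS₂] using s2
    · apply ext_bas
      intro m
      rw [mul_apply_eq_comp, hS₂, map_smul, hS₁, smul_smul, mul_inv_cancel₀, one_smul]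
      exact_mod_cast (hd m).ne'
  · refine Summable.of_nonneg_of_le (fun _ => norm_nonneg _) (fun m => ?_) (hsum.mul_left C)
    refine (norm_inner_le_norm _ _).trans ?_
    rw [norm_bas, mul_one]
    exact hT m

def coefZ (q : ℝ) (n k i : ℕ) (m : Fin n → ℕ) : ℝ :=
  if Vmem n k m then
    (if i < k then q ^ (mval m i) *
          Real.sqrt (1 - q ^ (2 * ((mval m (i + 1) : ℝ) - (mval m i : ℝ) + 1)))
      else if i = k then q ^ (mval m k) else 0)
  else 0

lemma mval_add {n : ℕ} (m m' : Fin n → ℕ) (t : ℕ) : mval (m + m') t = mval m t + mval m' t := by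
  unfold mval; split_ifs <;> simp

lemma mval_eps (n i k t : ℕ) :
    mval (eps n i k) t = if i < t ∧ t ≤ k ∧ t ≤ n then 1 else 0 := by
  unfold mval eps
  by_cases h : 1 ≤ t ∧ t ≤ n
  · rw [dif_pos h]
    apply if_congr _ rfl rfl
    simp only
    omega
  · rw [dif_neg h, if_neg]
    omega

lemma eps_of_le (n i k : ℕ) (h : k ≤ i) : eps n i k = 0 := by
  funext t
  simp only [eps, Pi.zero_apply]
  rw [if_neg]; omega

lemma Z_apply {q : ℝ} {n k : ℕ} {Z : Fin (n + 1) → (Hsp n →L[ℂ] Hsp n)} (hZ : IsPiRep q n k Z)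
    (i : Fin (n + 1)) (m : Fin n → ℕ) :
    Z i (lp.single 2 m 1) = ((coefZ q n k i m : ℝ) : ℂ) • lp.single 2 (m + eps n i k) 1 := by
  obtain ⟨h1, h2, h3, h4⟩ := hZ
  unfold coefZ
  by_cases hV : Vmem n k m
  · rw [if_pos hV]
    rcases lt_trichotomy (i : ℕ) k with hi | hi | hi
    · rw [if_pos hi, h3 m hV i hi]
    · rw [if_neg (by omega), if_pos hi, h4 m hV i hi, eps_of_le _ _ _ hi.ge, add_zero]
    · rw [if_neg (by omega), if_neg (by omega), h1 i hi]; simp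
  · rw [if_neg hV, h2 m hV i]; simp

lemma starZ_coord {q : ℝ} {n k : ℕ} {Z : Fin (n + 1) → (Hsp n →L[ℂ] Hsp n)}
    (hZ : IsPiRep q n k Z)
    (i : Fin (n + 1)) (x y : Fin n → ℕ) :
    (star (Z i) (lp.single 2 x 1) : Hsp n) y =
      if y + eps n i k = x then ((coefZ q n k i y : ℝ) : ℂ) else 0 := by
  have h : (inner ℂ (lp.single 2 y 1 : Hsp n) (star (Z i) (lp.single 2 x 1)) : ℂ)
      = inner ℂ (Z i (lp.single 2 y 1)) (lp.single 2 x 1 : Hsp n) := by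
    rw [ContinuousLinearMap.star_eq_adjoint, ContinuousLinearMap.adjoint_inner_right]
  rw [lp.inner_single_left, Z_apply hZ, inner_smul_left, lp.inner_single_left] at h
  simp only [RCLike.inner_apply, map_one, mul_one, Complex.conj_ofReal] at h
  rw [h]
  split_ifs with hx
  · rw [hx, lp.single_apply_self, mul_one]
  · rw [lp.single_apply_ne _ _ _ hx, mul_zero]

lemma starZ_add {q : ℝ} {n k : ℕ} {Z : Fin (n + 1) → (Hsp n →L[ℂ] Hsp n)}
    (hZ : IsPiRep q n k Z) (i : Fin (n + 1)) (y : Fin n → ℕ) :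
    star (Z i) (lp.single 2 (y + eps n i k) 1) =
      ((coefZ q n k i y : ℝ) : ℂ) • (lp.single 2 y 1 : Hsp n) := by
  ext x
  rw [starZ_coord hZ, lp.coeFn_smul, Pi.smul_apply]
  split_ifs with h
  · rw [add_right_cancel h, lp.single_apply_self, smul_eq_mul, mul_one]
  · rw [lp.single_apply_ne _ _ _ (fun h' => h (by rw [h'])), smul_zero]

lemma starZ_none {q : ℝ} {n k : ℕ} {Z : Fin (n + 1) → (Hsp n →L[ℂ] Hsp n)}
    (hZ : IsPiRep q n k Z) (i : Fin (n + 1)) (x : Fin n → ℕ) (h : ∀ y, y + eps n i k ≠ x) :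
    star (Z i) (lp.single 2 x 1) = 0 := by
  ext y
  rw [starZ_coord hZ, if_neg (h y)]
  rfl

lemma p_add {q : ℝ} {n k : ℕ} {Z : Fin (n + 1) → (Hsp n →L[ℂ] Hsp n)}
    (hZ : IsPiRep q n k Z) (i l : Fin (n + 1)) (m y : Fin n → ℕ)
    (h : y + eps n i k = m + eps n l k) :
    (star (Z i) * Z l) (lp.single 2 m 1) =
      ((coefZ q n k l m * coefZ q n k i y : ℝ) : ℂ) • (lp.single 2 y 1 : Hsp n) := by
  rw [mul_apply_eq_comp, Z_apply hZ, map_smul, ← h, starZ_add hZ, smul_smul]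
  push_cast; rfl

lemma p_none {q : ℝ} {n k : ℕ} {Z : Fin (n + 1) → (Hsp n →L[ℂ] Hsp n)}
    (hZ : IsPiRep q n k Z) (i l : Fin (n + 1)) (m : Fin n → ℕ)
    (h : ∀ y, y + eps n i k ≠ m + eps n l k) :
    (star (Z i) * Z l) (lp.single 2 m 1) = 0 := by
  rw [mul_apply_eq_comp, Z_apply hZ, map_smul, starZ_none hZ _ _ h, smul_zero]

lemma coefZ_nonneg {q : ℝ} (hq0 : 0 < q) (n k i : ℕ) (m : Fin n → ℕ) : 0 ≤ coefZ q n k i m := by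
  unfold coefZ; split_ifs <;> positivity

lemma coefZ_le_pow {q : ℝ} (hq0 : 0 < q) (n k : ℕ) (m : Fin n → ℕ) :
    coefZ q n k k m ≤ q ^ (mval m k) := by
  unfold coefZ
  simp only [lt_irrefl, if_false, if_true]
  split_ifs
  · exact le_rfl
  · positivity

lemma coefZ_le_one {q : ℝ} (hq0 : 0 < q) (hq1 : q < 1) (n k i : ℕ) (m : Fin n → ℕ) :
    coefZ q n k i m ≤ 1 := by
  unfold coefZ; split_ifs
  · refine mul_le_one₀ (pow_le_one₀ hq0.le hq1.le) (Real.sqrt_nonneg _) ?_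
    rw [Real.sqrt_le_iff]
    have := Real.rpow_pos_of_pos hq0 (2 * ((mval m (i + 1) : ℝ) - (mval m i : ℝ) + 1))
    exact ⟨zero_le_one, by linarith⟩
  · exact pow_le_one₀ hq0.le hq1.le
  · norm_num
  · norm_num

lemma coefZ_of_gt (q : ℝ) {n k i : ℕ} (h : k < i) (m : Fin n → ℕ) : coefZ q n k i m = 0 := by
  unfold coefZ
  rw [if_neg (by omega : ¬ i < k), if_neg (by omega : ¬ i = k), ite_self]

lemma Vmem_succ_iff {n j : ℕ} {y : Fin n → ℕ}
    (htail : ∀ t : ℕ, j + 1 ≤ t → t + 1 ≤ n → mval y (t + 1) < mval y t) :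
    Vmem n (j + 1) y ↔ Vmem n j y ∧ mval y j ≤ mval y (j + 1) := by
  constructor
  · rintro ⟨h1, h2⟩
    refine ⟨⟨fun t ht ht' => h1 t ht (by omega), htail⟩, ?_⟩
    rcases Nat.eq_zero_or_pos j with rfl | hj
    · simp [mval]
    · exact h1 j hj le_rfl
  · rintro ⟨⟨h1, h2⟩, h3⟩
    refine ⟨fun t ht ht' => ?_, fun t ht ht' => htail t (by omega) ht'⟩
    rcases Nat.lt_or_ge t j with h | h
    · exact h1 t ht h
    · have : t = j := by omega
      subst this; exact h3

lemma coefZ_diff {q : ℝ} (hq0 : 0 < q) (hq1 : q < 1) {n j i : ℕ} (hij : i ≤ j) {y : Fin n → ℕ}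
    (htail : ∀ t : ℕ, j + 1 ≤ t → t + 1 ≤ n → mval y (t + 1) < mval y t)
    (h : i = j ∨ mval y j ≤ mval y (j + 1)) :
    |coefZ q n (j + 1) i y - coefZ q n j i y| ≤ q ^ (mval y (j + 1)) := by
  have hV := Vmem_succ_iff htail
  have hpos : 0 ≤ q ^ (mval y (j + 1)) := by positivity
  by_cases hle : mval y j ≤ mval y (j + 1)
  · by_cases hVj : Vmem n j y
    · have hVj1 : Vmem n (j + 1) y := hV.2 ⟨hVj, hle⟩
      unfold coefZ
      rw [if_pos hVj, if_pos hVj1, if_pos (by omega : i < j + 1)]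
      rcases Nat.lt_or_ge i j with hi | hi
      · rw [if_pos hi, sub_self, abs_zero]; exact hpos
      · have : i = j := by omega
        subst this
        rw [if_neg (lt_irrefl _), if_pos rfl]
        obtain ⟨d, hd⟩ := Nat.exists_eq_add_of_le hle
        have he : (2 * ((mval y (i + 1) : ℝ) - (mval y i : ℝ) + 1)) = ((2 * (d + 1) : ℕ) : ℝ) := by
          rw [hd]; push_cast; ring
        rw [he, Real.rpow_natCast]
        have hx0 : 0 ≤ q ^ (d + 1) := by positivity
        have hx1 : q ^ (d + 1) ≤ 1 := pow_le_one₀ hq0.le hq1.le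
        have hxd : q ^ (d + 1) ≤ q ^ d := pow_le_pow_of_le_one hq0.le hq1.le (by omega)
        have e2 : q ^ (2 * (d + 1)) = (q ^ (d + 1)) ^ 2 := by rw [← pow_mul, mul_comm]
        have hs1 : 1 - q ^ (d + 1) ≤ Real.sqrt (1 - q ^ (2 * (d + 1))) := by
          apply Real.le_sqrt_of_sq_le
          rw [e2]; nlinarith
        have hs2 : Real.sqrt (1 - q ^ (2 * (d + 1))) ≤ 1 := by
          rw [Real.sqrt_le_iff, e2]; exact ⟨zero_le_one, by nlinarith⟩
        rw [← mul_sub_one, abs_mul, abs_of_nonneg (by positivity), hd, pow_add]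
        apply mul_le_mul_of_nonneg_left _ (by positivity)
        rw [abs_le]; constructor <;> linarith
    · have hVj1 : ¬ Vmem n (j + 1) y := fun h => hVj (hV.1 h).1
      unfold coefZ
      rw [if_neg hVj, if_neg hVj1, sub_self, abs_zero]; exact hpos
  · have hi : i = j := h.resolve_right hle
    subst hi
    have hVj1 : ¬ Vmem n (i + 1) y := fun h => hle (hV.1 h).2
    have : coefZ q n (i + 1) i y = 0 := by unfold coefZ; rw [if_neg hVj1]
    rw [this, zero_sub, abs_neg, abs_of_nonneg (coefZ_nonneg hq0 _ _ _ _)]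
    exact (coefZ_le_pow hq0 _ _ _).trans (pow_le_pow_of_le_one hq0.le hq1.le (by omega))

def JJ (q : ℝ) (n j : ℕ) (A : Hsp n →L[ℂ] Hsp n) : Prop :=
  ∃ C : ℝ, ∀ m, Vmem n j m → Vmem n (j + 1) m →
    ‖A (lp.single 2 m 1)‖ ≤ C * q ^ (mval m (j + 1))

lemma JJ_add {q : ℝ} {n j : ℕ} {A B : Hsp n →L[ℂ] Hsp n} (hA : JJ q n j A) (hB : JJ q n j B) :
    JJ q n j (A + B) := by
  obtain ⟨C, hC⟩ := hA
  obtain ⟨D, hD⟩ := hB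
  refine ⟨C + D, fun m h1 h2 => ?_⟩
  rw [_root_.add_apply, add_mul]
  exact (norm_add_le _ _).trans (add_le_add (hC m h1 h2) (hD m h1 h2))

lemma JJ_smul {q : ℝ} {n j : ℕ} {A : Hsp n →L[ℂ] Hsp n} (c : ℂ) (hA : JJ q n j A) :
    JJ q n j (c • A) := by
  obtain ⟨C, hC⟩ := hA
  refine ⟨‖c‖ * C, fun m h1 h2 => ?_⟩
  rw [_root_.smul_apply, norm_smul, mul_assoc]
  exact mul_le_mul_of_nonneg_left (hC m h1 h2) (norm_nonneg _)

lemma JJ_mul {q : ℝ} {n j : ℕ} {A : Hsp n →L[ℂ] Hsp n} (B : Hsp n →L[ℂ] Hsp n)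
    (hA : JJ q n j A) : JJ q n j (B * A) := by
  obtain ⟨C, hC⟩ := hA
  refine ⟨‖B‖ * C, fun m h1 h2 => ?_⟩
  rw [mul_apply_eq_comp, mul_assoc]
  exact (B.le_opNorm _).trans (mul_le_mul_of_nonneg_left (hC m h1 h2) (norm_nonneg _))

lemma norm_smul_bas {n : ℕ} (c : ℝ) (y : Fin n → ℕ) :
    ‖((c : ℝ) : ℂ) • (lp.single 2 y 1 : Hsp n)‖ = |c| := by
  rw [norm_smul, norm_bas, mul_one, Complex.norm_real, Real.norm_eq_abs]

lemma mval_rel {n i l k : ℕ} {m y : Fin n → ℕ} (h : y + eps n i k = m + eps n l k) (t : ℕ) :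
    mval y t + (if i < t ∧ t ≤ k ∧ t ≤ n then 1 else 0) =
    mval m t + (if l < t ∧ t ≤ k ∧ t ≤ n then 1 else 0) := by
  rw [← mval_eps, ← mval_eps, ← mval_add, ← mval_add, h]

lemma JJ_right {q : ℝ} (hq0 : 0 < q) (hq1 : q < 1) {n j : ℕ} (hj : j + 1 ≤ n)
    {Z : Fin (n + 1) → (Hsp n →L[ℂ] Hsp n)} (hZ : IsPiRep q n j Z) (i l : Fin (n + 1))
    {A : Hsp n →L[ℂ] Hsp n} (hA : JJ q n j A) : JJ q n j (A * (star (Z i) * Z l)) := by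
  obtain ⟨C, hC⟩ := hA
  refine ⟨|C| + ‖A‖, fun m h1 h2 => ?_⟩
  have hpw : 0 < q ^ (mval m (j + 1)) := by positivity
  rw [mul_apply_eq_comp]
  by_cases hy : ∃ y, y + eps n i j = m + eps n l j
  · obtain ⟨y, hy⟩ := hy
    have hr := mval_rel hy
    rw [p_add hZ i l m y hy, map_smul, norm_smul, Complex.norm_real, Real.norm_eq_abs,
      abs_of_nonneg (mul_nonneg (coefZ_nonneg hq0 _ _ _ _) (coefZ_nonneg hq0 _ _ _ _))]
    have b1 := coefZ_le_one hq0 hq1 n j l m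
    have b2 := coefZ_le_one hq0 hq1 n j i y
    have c1 := coefZ_nonneg hq0 n j l m
    have c2 := coefZ_nonneg hq0 n j i y
    have hAy : ‖A (lp.single 2 y 1)‖ ≤ ‖A‖ := by
      simpa [norm_bas] using A.le_opNorm (lp.single 2 y 1)
    have hm1 : mval y (j + 1) = mval m (j + 1) := by
      have := hr (j + 1)
      rw [if_neg (by omega), if_neg (by omega)] at this
      exact this
    have htail : ∀ t : ℕ, j + 1 ≤ t → t + 1 ≤ n → mval y (t + 1) < mval y t := by
      intro t ht ht'
      have a1 := hr t
      have a2 := hr (t + 1)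
      rw [if_neg (by omega), if_neg (by omega)] at a1 a2
      have := h1.2 t ht ht'
      omega
    by_cases hyV : Vmem n j y
    · by_cases hle : mval y j ≤ mval y (j + 1)
      · have hyV1 := (Vmem_succ_iff htail).2 ⟨hyV, hle⟩
        have := hC y hyV hyV1
        rw [hm1] at this
        have h3 : ‖A (lp.single 2 y 1)‖ ≤ |C| * q ^ mval m (j + 1) :=
          this.trans (mul_le_mul_of_nonneg_right (le_abs_self C) hpw.le)
        calc _ ≤ 1 * ‖A (lp.single 2 y 1)‖ :=
              mul_le_mul_of_nonneg_right (mul_le_one₀ b1 c2 b2) (norm_nonneg _)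
          _ ≤ |C| * q ^ mval m (j + 1) := by rw [one_mul]; exact h3
          _ ≤ _ := by
            apply mul_le_mul_of_nonneg_right _ hpw.le
            linarith [norm_nonneg A]
      · have hmle := ((Vmem_succ_iff h1.2).1 h2).2
        have hij : j ≤ (i : ℕ) := by
          by_contra hcon
          have a1 := hr j
          split_ifs at a1 <;> omega
        have hci : coefZ q n j i y ≤ q ^ (mval m (j + 1)) := by
          rcases hij.eq_or_lt with he | hlt
          · rw [← he]
            exact (coefZ_le_pow hq0 _ _ _).trans (pow_le_pow_of_le_one hq0.le hq1.le (by omega))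
          · rw [coefZ_of_gt q hlt]; exact hpw.le
        calc _ ≤ (1 * q ^ (mval m (j + 1))) * ‖A‖ :=
              mul_le_mul (mul_le_mul b1 hci c2 zero_le_one) hAy (norm_nonneg _) (by positivity)
          _ ≤ _ := by
            rw [one_mul, mul_comm]
            apply mul_le_mul_of_nonneg_right _ hpw.le
            linarith [abs_nonneg C]
    · have : coefZ q n j i y = 0 := by unfold coefZ; rw [if_neg hyV]
      rw [this, mul_zero, zero_mul]; positivity
  · push Not at hy
    rw [p_none hZ i l m hy, map_zero, norm_zero]
    positivity

lemma JJ_gen {q : ℝ} (hq0 : 0 < q) (hq1 : q < 1) {n j : ℕ} (hj : j + 1 ≤ n)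
    {Z Z' : Fin (n + 1) → (Hsp n →L[ℂ] Hsp n)} (hZ : IsPiRep q n j Z)
    (hZ' : IsPiRep q n (j + 1) Z') (i l : Fin (n + 1)) :
    JJ q n j (star (Z' i) * Z' l - star (Z i) * Z l) := by
  refine ⟨2, fun m h1 h2 => ?_⟩
  have hpw : 0 < q ^ (mval m (j + 1)) := by positivity
  rw [_root_.sub_apply]
  by_cases hil : (i : ℕ) ≤ j ∧ (l : ℕ) ≤ j
  · obtain ⟨hi, hl⟩ := hil
    have hE : ∀ s : ℕ, s ≤ j → eps n s (j + 1) = eps n s j + eps n j (j + 1) := by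
      intro s hs
      funext t
      simp only [eps, Pi.add_apply]
      split_ifs <;> omega
    have heq : ∀ y : Fin n → ℕ, y + eps n i (j + 1) = m + eps n l (j + 1) ↔
        y + eps n i j = m + eps n l j := by
      intro y
      rw [hE _ hi, hE _ hl, ← add_assoc, ← add_assoc, add_left_inj]
    by_cases hy : ∃ y, y + eps n i j = m + eps n l j
    · obtain ⟨y, hy⟩ := hy
      have hr := mval_rel hy
      rw [p_add hZ i l m y hy, p_add hZ' i l m y ((heq y).2 hy), ← sub_smul,
        ← Complex.ofReal_sub, norm_smul_bas]
      have hm1 : mval y (j + 1) = mval m (j + 1) := by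
        have := hr (j + 1)
        rw [if_neg (by omega), if_neg (by omega)] at this
        exact this
      have htail : ∀ t : ℕ, j + 1 ≤ t → t + 1 ≤ n → mval y (t + 1) < mval y t := by
        intro t ht ht'
        have a1 := hr t
        have a2 := hr (t + 1)
        rw [if_neg (by omega), if_neg (by omega)] at a1 a2
        have := h1.2 t ht ht'
        omega
      have hmle := ((Vmem_succ_iff h1.2).1 h2).2
      have d1 := coefZ_diff hq0 hq1 hl h1.2 (Or.inr hmle)
      have d2 := coefZ_diff hq0 hq1 hi htail (by
        by_cases hij : (i : ℕ) = j
        · exact Or.inl hij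
        · right
          have a1 := hr j
          split_ifs at a1 <;> omega)
      rw [hm1] at d2
      have b1 := coefZ_le_one hq0 hq1 n (j + 1) l m
      have b2 := coefZ_le_one hq0 hq1 n j i y
      have c1 := coefZ_nonneg hq0 n (j + 1) l m
      have c2 := coefZ_nonneg hq0 n j i y
      have e : coefZ q n (j + 1) l m * coefZ q n (j + 1) i y - coefZ q n j l m * coefZ q n j i y
        = coefZ q n (j + 1) l m * (coefZ q n (j + 1) i y - coefZ q n j i y)
          + (coefZ q n (j + 1) l m - coefZ q n j l m) * coefZ q n j i y := by ring
      rw [e]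
      refine (abs_add_le _ _).trans ?_
      rw [abs_mul, abs_mul, abs_of_nonneg c1, abs_of_nonneg c2]
      have f1 := mul_le_mul b1 d2 (abs_nonneg _) zero_le_one
      have f2 := mul_le_mul d1 b2 c2 hpw.le
      linarith
    · push Not at hy
      rw [p_none hZ i l m hy, p_none hZ' i l m (fun y h => hy y ((heq y).1 h)), sub_zero, norm_zero]
      positivity
  · have hz : (star (Z i) * Z l) (lp.single 2 m 1) = 0 := by
      by_cases hy : ∃ y, y + eps n i j = m + eps n l j
      · obtain ⟨y, hy⟩ := hy
        rw [p_add hZ i l m y hy]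
        rcases not_and_or.1 hil with h | h
        · rw [coefZ_of_gt q (not_le.1 h)]; simp
        · rw [coefZ_of_gt q (not_le.1 h)]; simp
      · push Not at hy
        exact p_none hZ i l m hy
    rw [hz, sub_zero]
    by_cases hy : ∃ y, y + eps n i (j + 1) = m + eps n l (j + 1)
    · obtain ⟨y, hy⟩ := hy
      have hr := mval_rel hy (j + 1)
      rw [p_add hZ' i l m y hy, norm_smul_bas,
        abs_of_nonneg (mul_nonneg (coefZ_nonneg hq0 _ _ _ _) (coefZ_nonneg hq0 _ _ _ _))]
      have b1 := coefZ_le_one hq0 hq1 n (j + 1) l m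
      have b2 := coefZ_le_one hq0 hq1 n (j + 1) i y
      have c1 := coefZ_nonneg hq0 n (j + 1) l m
      have c2 := coefZ_nonneg hq0 n (j + 1) i y
      have key : ∀ (s : ℕ) (x : Fin n → ℕ), ¬ s ≤ j → mval m (j + 1) ≤ mval x (j + 1) →
          coefZ q n (j + 1) s x ≤ q ^ (mval m (j + 1)) := by
        intro s x hs hx
        have hs' : j + 1 ≤ s := Nat.lt_of_not_le hs
        rcases eq_or_lt_of_le hs' with he | hlt
        · rw [← he]
          exact (coefZ_le_pow hq0 _ _ _).trans (pow_le_pow_of_le_one hq0.le hq1.le hx)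
        · rw [coefZ_of_gt q hlt]; exact hpw.le
      rcases not_and_or.1 hil with h | h
      · have := key i y h (by split_ifs at hr <;> omega)
        have f1 := mul_le_mul b1 this c2 zero_le_one
        linarith
      · have := key l m h le_rfl
        have f1 := mul_le_mul this b2 c2 hpw.le
        linarith
    · push Not at hy
      rw [p_none hZ' i l m hy, norm_zero]
      positivity

lemma JJ_all {q : ℝ} (hq0 : 0 < q) (hq1 : q < 1) {n j : ℕ} (hj : j + 1 ≤ n)
    {Z Z' : Fin (n + 1) → (Hsp n →L[ℂ] Hsp n)} (hZ : IsPiRep q n j Z)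
    (hZ' : IsPiRep q n (j + 1) Z')
    (ρ ρ' : FreeAlgebra ℂ (Fin (n + 1) × Fin (n + 1)) →ₐ[ℂ] (Hsp n →L[ℂ] Hsp n))
    (h : ∀ il, ρ (FreeAlgebra.ι ℂ il) = star (Z il.1) * Z il.2)
    (h' : ∀ il, ρ' (FreeAlgebra.ι ℂ il) = star (Z' il.1) * Z' il.2)
    (a : FreeAlgebra ℂ (Fin (n + 1) × Fin (n + 1))) : JJ q n j (ρ' a - ρ a) := by
  suffices H : (∀ A, JJ q n j A → JJ q n j (A * ρ a)) ∧ JJ q n j (ρ' a - ρ a) from H.2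
  induction a using FreeAlgebra.induction with
  | grade0 r =>
    constructor
    · intro A hA
      rw [AlgHom.commutes, ← Algebra.commutes, ← Algebra.smul_def]
      exact JJ_smul r hA
    · rw [AlgHom.commutes, AlgHom.commutes, sub_self]
      exact ⟨0, fun m _ _ => by simp⟩
  | grade1 x =>
    constructor
    · intro A hA
      rw [h]
      exact JJ_right hq0 hq1 hj hZ _ _ hA
    · rw [h, h']
      exact JJ_gen hq0 hq1 hj hZ hZ' _ _
  | mul a b ha hb =>
    constructor
    · intro A hA
      rw [map_mul, ← mul_assoc]
      exact hb.1 _ (ha.1 _ hA)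
    · have : ρ' (a * b) - ρ (a * b) = ρ' a * (ρ' b - ρ b) + (ρ' a - ρ a) * ρ b := by
        rw [map_mul, map_mul]; noncomm_ring
      rw [this]
      exact JJ_add (JJ_mul _ hb.2) (hb.1 _ ha.2)
  | add a b ha hb =>
    constructor
    · intro A hA
      rw [map_add, mul_add]
      exact JJ_add (ha.1 _ hA) (hb.1 _ hA)
    · have : ρ' (a + b) - ρ (a + b) = (ρ' a - ρ a) + (ρ' b - ρ b) := by
        rw [map_add, map_add]; abel
      rw [this]
      exact JJ_add ha.2 hb.2

lemma PrhoP {q : ℝ} {n k : ℕ} {Z : Fin (n + 1) → (Hsp n →L[ℂ] Hsp n)} (hZ : IsPiRep q n k Z)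
    (P : Hsp n →L[ℂ] Hsp n)
    (hP : ∀ m : Fin n → ℕ, P (lp.single 2 m 1) = if Vmem n k m then lp.single 2 m 1 else 0)
    (ρ : FreeAlgebra ℂ (Fin (n + 1) × Fin (n + 1)) →ₐ[ℂ] (Hsp n →L[ℂ] Hsp n))
    (h : ∀ il, ρ (FreeAlgebra.ι ℂ il) = star (Z il.1) * Z il.2)
    (a : FreeAlgebra ℂ (Fin (n + 1) × Fin (n + 1))) : P * ρ a * P = ρ a * P := by
  have hPP : P * P = P := by
    apply ext_bas
    intro m
    rw [mul_apply_eq_comp, hP]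
    split_ifs with hm
    · rw [hP, if_pos hm]
    · simp
  induction a using FreeAlgebra.induction with
  | grade0 r =>
    rw [AlgHom.commutes, ← Algebra.commutes, mul_assoc, hPP]
  | grade1 x =>
    rw [h]
    have : P * (star (Z x.1) * Z x.2) = star (Z x.1) * Z x.2 := by
      apply ext_bas
      intro m
      rw [mul_apply_eq_comp P]
      by_cases hy : ∃ y, y + eps n x.1 k = m + eps n x.2 k
      · obtain ⟨y, hy⟩ := hy
        rw [p_add hZ _ _ m y hy, map_smul, hP]
        split_ifs with hV
        · rfl
        · have : coefZ q n k x.1 y = 0 := by unfold coefZ; rw [if_neg hV]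
          rw [this]; simp
      · push Not at hy
        rw [p_none hZ _ _ m hy, map_zero]
    rw [this]
  | mul a b ha hb =>
    rw [map_mul]
    calc P * (ρ a * ρ b) * P = P * ρ a * (ρ b * P) := by noncomm_ring
      _ = P * ρ a * (P * ρ b * P) := by rw [hb]
      _ = (P * ρ a * P) * (ρ b * P) := by noncomm_ring
      _ = ρ a * (P * ρ b * P) := by rw [ha]; noncomm_ring
      _ = _ := by rw [hb, mul_assoc]
  | add a b ha hb =>
    rw [map_add, mul_add, add_mul, add_mul, ha, hb]

lemma W_max {n j : ℕ} (hj : j + 1 ≤ n) {m : Fin n → ℕ} (h1 : Vmem n j m) (h2 : Vmem n (j + 1) m) :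
    ∑ t, m t ≤ n * mval m (j + 1) := by
  have up : ∀ d t : ℕ, 1 ≤ t → t + d = j + 1 → mval m t ≤ mval m (j + 1) := by
    intro d
    induction d with
    | zero => intro t _ h; rw [← h]; rfl
    | succ d ih =>
      intro t ht h
      exact (h2.1 t ht (by omega)).trans (ih (t + 1) (by omega) (by omega))
  have down : ∀ d : ℕ, j + 1 + d ≤ n → mval m (j + 1 + d) ≤ mval m (j + 1) := by
    intro d
    induction d with
    | zero => intro _; rfl
    | succ d ih =>
      intro h
      exact (h1.2 (j + 1 + d) (by omega) (by omega)).le.trans (ih (by omega))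
  have : ∀ t : Fin n, m t ≤ mval m (j + 1) := by
    intro t
    have e : m t = mval m (t + 1) := by
      unfold mval
      rw [dif_pos ⟨by omega, by omega⟩]
      rfl
    rw [e]
    rcases le_total ((t : ℕ) + 1) (j + 1) with h | h
    · exact up (j - t) _ (by omega) (by omega)
    · obtain ⟨d, hd⟩ := Nat.exists_eq_add_of_le h
      rw [hd]
      exact down d (by omega)
  calc ∑ t, m t ≤ ∑ _t : Fin n, mval m (j + 1) := Finset.sum_le_sum fun t _ => this t
    _ = _ := by simp

lemma V_decomp {n : ℕ} (hn : 1 ≤ n) (m : Fin n → ℕ) (E : Type*) [AddCommGroup E] [Module ℂ E] (x : ℕ → E) :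
    ∑ k ∈ Finset.range (n + 1), ((-1 : ℂ) ^ k) • (if Vmem n k m then x k else 0)
    = ∑ j ∈ Finset.range n, ((-1 : ℂ) ^ (j + 1)) •
        (if Vmem n j m ∧ Vmem n (j + 1) m then x (j + 1) - x j else 0) := by
  let f : ℕ → E := fun k => ((-1 : ℂ) ^ k) •
    (if k < n ∧ Vmem n k m ∧ Vmem n (k + 1) m then x k else 0)
  let g : ℕ → E := fun k => ((-1 : ℂ) ^ k) •
    (if 1 ≤ k ∧ Vmem n (k - 1) m ∧ Vmem n k m then x k else 0)
  have hfg : ∀ k ∈ Finset.range (n + 1),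
      ((-1 : ℂ) ^ k) • (if Vmem n k m then x k else 0) = f k + g k := by
    intro k hk
    have hk : k ≤ n := by simpa [Nat.lt_succ_iff] using hk
    simp only [f, g]
    rw [← smul_add]
    congr 1
    by_cases hV : Vmem n k m
    · have hA : (k < n ∧ Vmem n k m ∧ Vmem n (k + 1) m) ↔ (k < n ∧ mval m k ≤ mval m (k + 1)) := by
        rw [Vmem_succ_iff hV.2]; tauto
      have hB : (1 ≤ k ∧ Vmem n (k - 1) m ∧ Vmem n k m) ↔
          (1 ≤ k ∧ (k + 1 ≤ n → mval m (k + 1) < mval m k)) := by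
        constructor
        · rintro ⟨h1, h2, _⟩
          exact ⟨h1, fun h => h2.2 k (by omega) h⟩
        · rintro ⟨h1, h2⟩
          refine ⟨h1, ⟨fun t ht ht' => hV.1 t ht (by omega), fun t ht ht' => ?_⟩, hV⟩
          rcases Nat.lt_or_ge k t with h | h
          · exact hV.2 t h ht'
          · have : t = k := by omega
            subst this; exact h2 ht'
      rw [if_pos hV]
      simp only [hA, hB]
      have h0 : k = 0 → mval m k = 0 := by rintro rfl; simp [mval]
      by_cases h : k < n ∧ mval m k ≤ mval m (k + 1)
      · rw [if_pos h, if_neg (by omega), add_zero]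
      · rw [if_neg h, if_pos (by omega), zero_add]
    · simp [hV]
  rw [Finset.sum_congr rfl hfg, Finset.sum_add_distrib, Finset.sum_range_succ, Finset.sum_range_succ' g]
  have hfn : f n = 0 := by simp [f]
  have hg0 : g 0 = 0 := by simp [g]
  rw [hfn, hg0, add_zero, add_zero, ← Finset.sum_add_distrib]
  refine Finset.sum_congr rfl fun j hj => ?_
  have hj : j < n := by simpa using hj
  simp only [f, g, hj, true_and, Nat.add_sub_cancel, Nat.le_add_left]
  split_ifs
  · rw [pow_succ, smul_sub]; simp; abel
  · simp

theorem piPlus_sub_piMinus_traceClass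
    (q : ℝ) (hq0 : 0 < q) (hq1 : q < 1) (n : ℕ) (hn : 1 ≤ n)
    -- the representations π_{n,k}, 0 ≤ k ≤ n
    (Z : ℕ → Fin (n + 1) → (Hsp n →L[ℂ] Hsp n))
    (hZ : ∀ k ≤ n, IsPiRep q n k (Z k))
    -- P k is the orthogonal projection onto V^n_k, i.e. π_{n,k}(1)
    (P : ℕ → (Hsp n →L[ℂ] Hsp n))
    (hP : ∀ k ≤ n, ∀ m : Fin n → ℕ,
      P k (lp.single 2 m 1) = if Vmem n k m then lp.single 2 m 1 else 0)
    -- ρ k : the (unital) representation of noncommutative polynomials in the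
    -- generators p_{il} of A(CP^n_q), sending p_{il} to π_{n,k}(z_i)^* π_{n,k}(z_l)
    (ρ : ℕ → (FreeAlgebra ℂ (Fin (n + 1) × Fin (n + 1)) →ₐ[ℂ] (Hsp n →L[ℂ] Hsp n)))
    (hρ : ∀ k, ρ k = FreeAlgebra.lift ℂ
      (fun il : Fin (n + 1) × Fin (n + 1) => star (Z k il.1) * Z k il.2)) :
    -- for every a ∈ A(CP^n_q), the operator π_+^{(n)}(a) - π_-^{(n)}(a)
    ∀ a : FreeAlgebra ℂ (Fin (n + 1) × Fin (n + 1)),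
      IsTraceClass
        (∑ k ∈ Finset.range (n + 1), ((-1 : ℂ) ^ k) • (P k * ρ k a * P k))
      -- the trace is given by an absolutely convergent series
      ∧ Summable (fun m : Fin n → ℕ =>
          ‖(inner ℂ ((∑ k ∈ Finset.range (n + 1),
              ((-1 : ℂ) ^ k) • (P k * ρ k a * P k)) (lp.single 2 m 1))
            (lp.single 2 m 1) : ℂ)‖) := by
  intro a
  have hι : ∀ k il, ρ k (FreeAlgebra.ι ℂ il) = star (Z k il.1) * Z k il.2 := by
    intro k il
    rw [hρ, FreeAlgebra.lift_ι_apply]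
  have hJ : ∀ j, ∃ C : ℝ, 0 ≤ C ∧ (j < n → ∀ m, Vmem n j m → Vmem n (j + 1) m →
      ‖(ρ (j + 1) a - ρ j a) (lp.single 2 m 1)‖ ≤ C * q ^ (mval m (j + 1))) := by
    intro j
    by_cases hj : j < n
    · obtain ⟨C, hC⟩ := JJ_all hq0 hq1 hj (hZ j hj.le) (hZ (j + 1) hj) (ρ j) (ρ (j + 1))
        (hι j) (hι (j + 1)) a
      refine ⟨|C|, abs_nonneg _, fun _ m h1 h2 => (hC m h1 h2).trans ?_⟩
      exact mul_le_mul_of_nonneg_right (le_abs_self C) (by positivity)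
    · exact ⟨0, le_rfl, fun h => absurd h hj⟩
  choose C hC0 hC using hJ
  obtain ⟨r, hr0, hr1, hr⟩ : ∃ r : ℝ, 0 < r ∧ r < 1 ∧ r ^ (2 * n) = q := by
    refine ⟨q ^ ((2 * n : ℕ) : ℝ)⁻¹, Real.rpow_pos_of_pos hq0 _, ?_, ?_⟩
    · apply Real.rpow_lt_one hq0.le hq1
      have : (0 : ℝ) < ((2 * n : ℕ) : ℝ) := by exact_mod_cast (by omega : 0 < 2 * n)
      positivity
    · exact Real.rpow_inv_natCast_pow hq0.le (by omega)
  apply traceClass_of_bound r (∑ j ∈ Finset.range n, C j) hr0 hr1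
  intro m
  have hT : (∑ k ∈ Finset.range (n + 1), ((-1 : ℂ) ^ k) • (P k * ρ k a * P k)) (lp.single 2 m 1)
      = ∑ k ∈ Finset.range (n + 1), ((-1 : ℂ) ^ k) •
        (if Vmem n k m then ρ k a (lp.single 2 m 1) else 0) := by
    rw [ContinuousLinearMap.sum_apply]
    refine Finset.sum_congr rfl fun k hk => ?_
    have hk : k ≤ n := by simpa [Nat.lt_succ_iff] using hk
    rw [PrhoP (hZ k hk) (P k) (hP k hk) (ρ k) (hι k) a, _root_.smul_apply, mul_apply_eq_comp,
      hP k hk]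
    split_ifs
    · rfl
    · rw [map_zero]
  rw [hT, V_decomp hn m (Hsp n) (fun k => ρ k a (lp.single 2 m 1)), Finset.sum_mul]
  refine (norm_sum_le _ _).trans (Finset.sum_le_sum fun j hj => ?_)
  have hj : j < n := by simpa using hj
  rw [norm_smul, norm_pow, norm_neg, norm_one, one_pow, one_mul]
  split_ifs with hW
  · refine (hC j hj m hW.1 hW.2).trans (mul_le_mul_of_nonneg_left ?_ (hC0 j))
    rw [← hr, ← pow_mul, ← pow_mul]
    apply pow_le_pow_of_le_one hr0.le hr1.le
    have := W_max hj hW.1 hW.2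
    nlinarith
  · rw [norm_zero]
    exact mul_nonneg (hC0 j) (by positivity)

end
end

section
/- For every 0 ≤ k ≤ n, the 2k-cochain τ_k defined by τ_k(a_0,a_1,…,a_{2k}) = h( a_0 · (∂̄a_k^* ∧_q ⋯ ∧_q ∂̄a_1^*)^* · (∂̄a_{k+1} ∧_q ⋯ ∧_q ∂̄a_{2k}) ) (with τ_0 := h) is a twisted Hochschild cocycle, b_η τ_k = 0, representing a class in H H^{2k}_η(A(CP^n_q)); moreover τ_k is positive, i.e. the sesquilinear form ⟨a_0⊗⋯⊗a_k, b_0⊗⋯⊗b_k⟩ := τ_k(η(b_0^*)a_0, a_1,…,a_k, b_k^*,…,b_1^*) is positive semidefinite. -/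
/-!
STATEMENT 18: For every `0 ≤ k ≤ n`, the `2k`-cochain
`τ_k(a_0,…,a_{2k}) = h(a_0 (∂̄a_k^* ∧_q ⋯ ∧_q ∂̄a_1^*)^* · (∂̄a_{k+1} ∧_q ⋯ ∧_q ∂̄a_{2k}))`
(with `τ_0 := h`) is a twisted Hochschild cocycle, `b_η τ_k = 0`, representing a class
in `HH^{2k}_η(A(CP^n_q))`, and it is positive: the associated sesquilinear form is
positive semidefinite.

`(0,k)`-forms are realized by their components over strictly increasing `k`-tuples of
indices in `{1,…,n}`; the wedge `∂̄a_1 ∧_q ⋯ ∧_q ∂̄a_k` has components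
`∑_{p ∈ S_k} (-q⁻¹)^{||p||} (∂̄a_1)_{i_{p(1)}} ⋯ (∂̄a_k)_{i_{p(k)}}`, and the pairing of
two vectors of forms is `∑_v star(ω_v) ω'_v`.
-/

noncomputable section
open scoped Classical ComplexConjugate

/-- the length (number of inversions) `||p||` of a permutation. -/
def invCount {k : ℕ} (p : Equiv.Perm (Fin k)) : ℕ :=
  (Finset.univ.filter (fun x : Fin k × Fin k => x.1 < x.2 ∧ p x.2 < p x.1)).card

/-- the component at the tuple `v` of the wedge product `∂̄c_1 ∧_q ⋯ ∧_q ∂̄c_k`. -/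
def Wdg {A : Type*} [Ring A] [Algebra ℂ A] (q : ℝ) {nn k : ℕ}
    (db : A →ₗ[ℂ] (Fin nn → A)) (c : Fin k → A) (v : Fin k → Fin nn) : A :=
  ∑ p : Equiv.Perm (Fin k),
    ((-(q : ℂ)⁻¹) ^ invCount p) •
      ((List.finRange k).map (fun l => db (c l) (v (p l)))).prod

/-- the cochain `τ_k(a_0,…,a_{2k})`; for `k = 0` it is `h(a_0)`. -/
def tauC {A : Type*} [Ring A] [Algebra ℂ A] [StarRing A] (q : ℝ) {nn : ℕ}
    (db : A →ₗ[ℂ] (Fin nn → A)) (h : A →ₗ[ℂ] ℂ) (k : ℕ) (a : ℕ → A) : ℂ :=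
  h (a 0 * ∑ v : Fin k → Fin nn,
    if StrictMono v then
      star (Wdg q db (fun l => star (a (k - (l : ℕ)))) v) *
        Wdg q db (fun l => a (k + 1 + (l : ℕ))) v
    else 0)

/-- the twisted Hochschild coboundary of the `2k`-cochain `τ_k`, evaluated at
`(a_0, …, a_{2k+1})`. -/
def btau {A : Type*} [Ring A] [Algebra ℂ A] [StarRing A] (q : ℝ) {nn : ℕ}
    (db : A →ₗ[ℂ] (Fin nn → A)) (h : A →ₗ[ℂ] ℂ) (eta : A →ₐ[ℂ] A) (k : ℕ)
    (a : ℕ → A) : ℂ :=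
  (∑ i ∈ Finset.range (2 * k + 1), (-1 : ℂ) ^ i *
    tauC q db h k
      (fun j => if j < i then a j else if j = i then a i * a (i + 1) else a (j + 1)))
  + (-1 : ℂ) ^ (2 * k + 1) *
      tauC q db h k (fun j => if j = 0 then eta (a (2 * k + 1)) * a 0 else a j)

lemma prod_finRange_eq {A : Type*} [Ring A] {k : ℕ} (g : Fin k → A) :
    ((List.finRange k).map g).prod =
      ((List.range k).map (fun l => if h : l < k then g ⟨l, h⟩ else 1)).prod := by
  congr 1
  apply List.ext_getElem
  · simp
  · intro i h1 h2
    have : i < k := by simpa using h1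
    simp [this]

lemma star_list_prod_aux {A : Type*} [Ring A] [StarRing A] (l : List A) :
    star l.prod = (l.map star).reverse.prod := by
  induction l with
  | nil => simp
  | cons x l ih => simp [ih]

lemma star_prod_range {A : Type*} [Ring A] [StarRing A] (k : ℕ) (f : ℕ → A) :
    star ((List.range k).map f).prod =
      ((List.range k).map (fun l => star (f (k - 1 - l)))).prod := by
  rw [star_list_prod_aux]
  congr 1
  apply List.ext_getElem
  · simp
  · intro i h1 h2
    simp

def hT {A : Type*} [Ring A] (N : ℕ) (d : ℕ → A → A) (a : ℕ → A) : A :=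
  a 0 * ((List.range N).map (fun l => d l (a (l + 1)))).prod

lemma hT_succ {A : Type*} [Ring A] (N : ℕ) (d : ℕ → A → A) (a : ℕ → A) :
    hT (N + 1) d a = hT N d a * d N (a (N + 1)) := by
  simp [hT, List.range_succ, mul_assoc]

lemma hT_congr {A : Type*} [Ring A] (N : ℕ) (d : ℕ → A → A) (a b : ℕ → A)
    (hab : ∀ j ≤ N, a j = b j) : hT N d a = hT N d b := by
  unfold hT
  rw [hab 0 (Nat.zero_le _)]
  congr 2
  apply List.map_congr_left
  intro l hl
  rw [hab (l + 1) (by have := List.mem_range.1 hl; omega)]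

lemma hT_sum {A : Type*} [Ring A] [Algebra ℂ A] (d : ℕ → A → A) (a : ℕ → A)
    (hd : ∀ l i j, d l (a i * a j) = a i * d l (a j) + d l (a i) * a j) (N : ℕ) :
    ∑ i ∈ Finset.range (N + 1), (-1 : ℂ) ^ i •
      hT N d (fun j => if j < i then a j else if j = i then a i * a (i + 1) else a (j + 1))
    = (-1 : ℂ) ^ N • (hT N d a * a (N + 1)) := by
  induction N with
  | zero => simp [hT]
  | succ N ih =>
    rw [Finset.sum_range_succ]
    have h1 : ∀ i ∈ Finset.range (N + 1), (-1 : ℂ) ^ i •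
      hT (N + 1) d
        (fun j => if j < i then a j else if j = i then a i * a (i + 1) else a (j + 1))
      = ((-1 : ℂ) ^ i • hT N d
        (fun j => if j < i then a j else if j = i then a i * a (i + 1) else a (j + 1)))
        * d N (a (N + 2)) := by
      intro i hi
      have hi' := Finset.mem_range.1 hi
      rw [hT_succ, smul_mul_assoc]
      rw [if_neg (by omega), if_neg (by omega)]
    rw [Finset.sum_congr rfl h1, ← Finset.sum_mul, ih, hT_succ, hT_succ]
    rw [hT_congr N d (fun j => if j < N + 1 then a j else if j = N + 1 then
      a (N + 1) * a (N + 1 + 1) else a (j + 1)) a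
      (fun j hj => if_pos (by omega))]
    simp only [lt_irrefl, if_false, if_true, hd]
    simp only [pow_succ, mul_neg, mul_one, neg_smul, mul_add, smul_add, smul_mul_assoc,
      mul_assoc]
    abel

def hD {A : Type*} [Ring A] [Algebra ℂ A] [StarRing A] {nn k : ℕ}
    (db : A →ₗ[ℂ] (Fin nn → A)) (v : Fin k → Fin nn) (p p' : Equiv.Perm (Fin k))
    (l : ℕ) (x : A) : A :=
  if l < k then
    (if h : k - 1 - l < k then star (db (star x) (v (p ⟨k - 1 - l, h⟩))) else 1)
  else (if h : l - k < k then db x (v (p' ⟨l - k, h⟩)) else 1)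

lemma hT_hD {A : Type*} [Ring A] [Algebra ℂ A] [StarRing A] {nn k : ℕ}
    (db : A →ₗ[ℂ] (Fin nn → A)) (v : Fin k → Fin nn) (p p' : Equiv.Perm (Fin k))
    (a : ℕ → A) :
    hT (2 * k) (hD db v p p') a =
      a 0 * (star ((List.finRange k).map
          (fun l : Fin k => db (star (a (k - (l : ℕ)))) (v (p l)))).prod *
        ((List.finRange k).map (fun l : Fin k => db (a (k + 1 + (l : ℕ))) (v (p' l)))).prod) := by
  rw [prod_finRange_eq, prod_finRange_eq, star_prod_range, two_mul, hT, List.range_add,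
    List.map_append, List.prod_append, List.map_map]
  congr 3
  · apply List.map_congr_left
    intro l hl
    have hl := List.mem_range.1 hl
    have h1 : k - 1 - l < k := by omega
    have h2 : k - (k - 1 - l) = l + 1 := by omega
    simp [hD, hl, h1, h2]
  · apply List.map_congr_left
    intro l hl
    have hl := List.mem_range.1 hl
    have h2 : k + l + 1 = k + 1 + l := by omega
    simp [hD, hl, h2]

lemma tauC_eq {A : Type*} [Ring A] [Algebra ℂ A] [StarRing A] [StarModule ℂ A] (q : ℝ)
    {nn : ℕ} (db : A →ₗ[ℂ] (Fin nn → A)) (h : A →ₗ[ℂ] ℂ) (k : ℕ) (a : ℕ → A) :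
    tauC q db h k a = ∑ v : Fin k → Fin nn, ∑ p : Equiv.Perm (Fin k),
      ∑ p' : Equiv.Perm (Fin k),
      (if StrictMono v then star ((-(q : ℂ)⁻¹) ^ invCount p) * ((-(q : ℂ)⁻¹) ^ invCount p')
        else 0) * h (hT (2 * k) (hD db v p p') a) := by
  unfold tauC
  rw [Finset.mul_sum, map_sum]
  refine Finset.sum_congr rfl fun v _ => ?_
  split_ifs with hv
  · unfold Wdg
    rw [star_sum, Finset.sum_mul_sum, Finset.mul_sum, map_sum]
    refine Finset.sum_congr rfl fun p _ => ?_
    rw [Finset.mul_sum, map_sum]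
    refine Finset.sum_congr rfl fun p' _ => ?_
    rw [hT_hD, star_smul, smul_mul_smul_comm, mul_smul_comm, map_smul, smul_eq_mul]
  · simp

lemma btau_zero {A : Type*} [Ring A] [Algebra ℂ A] [StarRing A] [StarModule ℂ A] (q : ℝ)
    {nn : ℕ} (CP : StarSubalgebra ℂ A) (db : A →ₗ[ℂ] (Fin nn → A)) (h : A →ₗ[ℂ] ℂ)
    (eta : A →ₐ[ℂ] A) (htwist : ∀ x y : A, h (x * y) = h (eta y * x))
    (hLeib : ∀ a b : A, a ∈ CP → b ∈ CP →
      ∀ i : Fin nn, db (a * b) i = a * db b i + db a i * b)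
    (k : ℕ) (a : ℕ → A) (ha : ∀ j, a j ∈ CP) : btau q db h eta k a = 0 := by
  have key : ∀ (v : Fin k → Fin nn) (p p' : Equiv.Perm (Fin k)),
      (∑ i ∈ Finset.range (2 * k + 1), (-1 : ℂ) ^ i * h (hT (2 * k) (hD db v p p')
        (fun j => if j < i then a j else if j = i then a i * a (i + 1) else a (j + 1))))
      + (-1 : ℂ) ^ (2 * k + 1) * h (hT (2 * k) (hD db v p p')
        (fun j => if j = 0 then eta (a (2 * k + 1)) * a 0 else a j)) = 0 := by
    intro v p p'
    -- replace the operators beyond slot 2k by zero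
    let d : ℕ → A → A := fun l x => if l < 2 * k then hD db v p p' l x else 0
    have hTd : ∀ b, hT (2 * k) (hD db v p p') b = hT (2 * k) d b := by
      intro b
      unfold hT
      congr 2
      apply List.map_congr_left
      intro l hl
      simp [d, List.mem_range.1 hl]
    have hd : ∀ l i j, d l (a i * a j) = a i * d l (a j) + d l (a i) * a j := by
      intro l i j
      by_cases hl : l < 2 * k
      · by_cases hlk : l < k
        · have h1 : k - 1 - l < k := by omega
          simp only [d, hD, hl, hlk, h1, if_true, dif_pos, star_mul]
          rw [hLeib _ _ (star_mem (ha j)) (star_mem (ha i))]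
          simp [add_comm]
        · have h1 : l - k < k := by omega
          simp only [d, hD, hl, hlk, h1, if_true, if_false, dif_pos]
          rw [hLeib _ _ (ha i) (ha j)]
      · simp [d, hl]
    simp only [hTd]
    have hs := congrArg h (hT_sum d a hd (2 * k))
    simp only [map_sum, map_smul, smul_eq_mul] at hs
    rw [hs, htwist]
    have : eta (a (2 * k + 1)) * hT (2 * k) d a = hT (2 * k) d
        (fun j => if j = 0 then eta (a (2 * k + 1)) * a 0 else a j) := by
      simp [hT, mul_assoc]
    rw [this, pow_succ]
    ring
  unfold btau
  simp only [tauC_eq, Finset.mul_sum]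
  rw [Finset.sum_comm, ← Finset.sum_add_distrib]
  refine Finset.sum_eq_zero fun v _ => ?_
  rw [Finset.sum_comm, ← Finset.sum_add_distrib]
  refine Finset.sum_eq_zero fun p _ => ?_
  rw [Finset.sum_comm, ← Finset.sum_add_distrib]
  refine Finset.sum_eq_zero fun p' _ => ?_
  simp only [mul_left_comm ((-1 : ℂ) ^ _)]
  rw [← Finset.mul_sum, ← mul_add, key, mul_zero]

lemma tau_pos {A : Type*} [Ring A] [Algebra ℂ A] [StarRing A] [StarModule ℂ A] (q : ℝ)
    {nn : ℕ} (db : A →ₗ[ℂ] (Fin nn → A)) (h : A →ₗ[ℂ] ℂ)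
    (hpos : ∀ x : A, ∃ r : ℝ, 0 ≤ r ∧ h (star x * x) = (r : ℂ))
    (eta : A →ₐ[ℂ] A) (htwist : ∀ x y : A, h (x * y) = h (eta y * x))
    (k m : ℕ) (f : Fin m → ℕ → A) :
    ∃ r : ℝ, 0 ≤ r ∧
          (∑ s : Fin m, ∑ t : Fin m,
            tauC q db h k
              (fun j =>
                if j = 0 then eta (star ((f t) 0)) * (f s) 0
                else if j ≤ k then (f s) j
                else star ((f t) (2 * k + 1 - j))))
          = (r : ℂ) := by
  let W : Fin m → (Fin k → Fin nn) → A := fun s v =>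
    Wdg q db (fun l => star (f s (k - (l : ℕ)))) v
  let X : (Fin k → Fin nn) → A := fun v => ∑ s, W s v * star (f s 0)
  choose r hr0 hr using hpos
  have hst : ∀ s t : Fin m, tauC q db h k
              (fun j =>
                if j = 0 then eta (star ((f t) 0)) * (f s) 0
                else if j ≤ k then (f s) j
                else star ((f t) (2 * k + 1 - j)))
      = ∑ v : Fin k → Fin nn, if StrictMono v then
          h (star (W s v * star (f s 0)) * (W t v * star (f t 0))) else 0 := by
    intro s t
    unfold tauC
    rw [Finset.mul_sum, map_sum]
    refine Finset.sum_congr rfl fun v _ => ?_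
    split_ifs with hv
    · have e1 : (fun l : Fin k => star (if k - (l : ℕ) = 0 then
          eta (star ((f t) 0)) * (f s) 0 else if k - (l : ℕ) ≤ k then f s (k - (l : ℕ))
          else star ((f t) (2 * k + 1 - (k - (l : ℕ)))))) =
          fun l : Fin k => star (f s (k - (l : ℕ))) := by
        funext l
        have := l.2
        rw [if_neg (by omega), if_pos (by omega)]
      have e2 : (fun l : Fin k => if k + 1 + (l : ℕ) = 0 then
          eta (star ((f t) 0)) * (f s) 0 else if k + 1 + (l : ℕ) ≤ k then
          f s (k + 1 + (l : ℕ))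
          else star ((f t) (2 * k + 1 - (k + 1 + (l : ℕ))))) =
          fun l : Fin k => star (f t (k - (l : ℕ))) := by
        funext l
        have := l.2
        rw [if_neg (by omega), if_neg (by omega)]
        congr 2
        omega
      rw [e1, e2]
      simp only [if_true]
      rw [mul_assoc, ← htwist]
      simp only [W, star_mul, star_star, mul_assoc]
    · simp
  refine ⟨∑ v : Fin k → Fin nn, if StrictMono v then r (X v) else 0, ?_, ?_⟩
  · refine Finset.sum_nonneg fun v _ => ?_
    split_ifs
    · exact hr0 _
    · exact le_rfl
  · simp only [hst]
    push_cast
    rw [Finset.sum_congr rfl fun s _ => Finset.sum_comm, Finset.sum_comm]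
    refine Finset.sum_congr rfl fun v _ => ?_
    split_ifs with hv
    · rw [← hr]
      simp only [X, star_sum, Finset.sum_mul_sum, map_sum]
    · simp

theorem tau_positive_twisted_hochschild_cocycle
    (q : ℝ) (hq0 : 0 < q) (hq1 : q < 1) (n : ℕ) (hn : 1 ≤ n)
    (A : Type*) [Ring A] [Algebra ℂ A] [StarRing A] [StarModule ℂ A]
    -- A(CP^n_q) ⊂ A(SU_q(n+1))
    (CP : StarSubalgebra ℂ A)
    -- the Haar state h, positive, with modular automorphism η: h(ab) = h(η(b)a)
    (h : A →ₗ[ℂ] ℂ)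
    (hone : h 1 = 1)
    (hpos : ∀ x : A, ∃ r : ℝ, 0 ≤ r ∧ h (star x * x) = (r : ℂ))
    (hfaith : ∀ x : A, h (star x * x) = 0 → x = 0)
    (hstar : ∀ x : A, h (star x) = conj (h x))
    (eta : A →ₐ[ℂ] A)
    (htwist : ∀ x y : A, h (x * y) = h (eta y * x))
    -- the Dolbeault operator ∂̄ : A(CP^n_q) → Ω^{0,1}, with components ∂̄ = (𝓛_{K̂X_i})_i
    (db : A →ₗ[ℂ] (Fin n → A))
    -- componentwise Leibniz rule on A(CP^n_q)
    (hLeib : ∀ a b : A, a ∈ CP → b ∈ CP →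
      ∀ i : Fin n, db (a * b) i = a * db b i + db a i * b)
    (k : ℕ) (hk : k ≤ n) :
    -- τ_k is a twisted Hochschild cocycle: b_η τ_k = 0 on A(CP^n_q), so it
    -- represents a class in HH^{2k}_η(A(CP^n_q))
    (∀ a : ℕ → A, (∀ j, a j ∈ CP) → btau q db h eta k a = 0)
    -- τ_k is positive: the sesquilinear form
    -- ⟨a_0⊗⋯⊗a_k, b_0⊗⋯⊗b_k⟩ = τ_k(η(b_0^*)a_0, a_1,…,a_k, b_k^*,…,b_1^*)
    -- is positive semidefinite
    ∧ (∀ (m : ℕ) (f : Fin m → ℕ → A), (∀ s j, f s j ∈ CP) →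
        ∃ r : ℝ, 0 ≤ r ∧
          (∑ s : Fin m, ∑ t : Fin m,
            tauC q db h k
              (fun j =>
                if j = 0 then eta (star ((f t) 0)) * (f s) 0
                else if j ≤ k then (f s) j
                else star ((f t) (2 * k + 1 - j))))
          = (r : ℂ)) := by
  exact ⟨fun a ha => btau_zero q CP db h eta htwist hLeib k a ha,
    fun m f _ => tau_pos q db h hpos eta htwist k m f⟩

end
end
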